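/- arXiv:2303.15981 — 2 statements merged into one kernel-verified Lean document; each statement's English description precedes it below -/
import Mathlib

section
/- Let X be a super-refinable topological space and let n ≥ 1 be an integer. If X satisfies condition (DA_n), and additionally condition (DA_{n−1}) in case n ≥ 2, then Ȟ^n(X,ℛ) = 0 for every principal ideal domain ℛ. -/
/-- Discrete chains with `m` vertices: the free `ℤ`-module on ordered `m`-tuples of points. -/
abbrev DChain (α : Type*) (m : ℕ) := (Fin m → α) →₀ ℤ

/-- The `i`-th face operator on discrete chains, deleting the `i`-th vertex. -/
noncomputable def dface {α : Type*} {m : ℕ} (i : Fin (m + 1)) :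
    DChain α (m + 1) →ₗ[ℤ] DChain α m :=
  Finsupp.lmapDomain ℤ ℤ (fun σ => σ ∘ i.succAbove)

/-- The simplicial boundary operator on discrete chains:
`∂[x₀,…,xₙ] = ∑ i, (-1)^i [x₀,…,x̂ᵢ,…,xₙ]`. -/
noncomputable def dbd {α : Type*} {m : ℕ} : DChain α (m + 1) →ₗ[ℤ] DChain α m :=
  ∑ i : Fin (m + 1), ((-1 : ℤ) ^ (i : ℕ)) • dface i

/-- The chain map induced by a map on vertices. -/
noncomputable def vmap {α β : Type*} (f : α → β) {m : ℕ} : DChain α m →ₗ[ℤ] DChain β m :=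
  Finsupp.lmapDomain ℤ ℤ (fun σ => f ∘ σ)

/-- The support of a discrete chain: the set of vertices appearing in its
cancellation-free expression. -/
def chainSupp {α : Type*} {m : ℕ} (c : DChain α m) : Set α :=
  ⋃ σ ∈ c.support, Set.range σ

/-- An open cover of a topological space. -/
def IsOpenCover {X : Type*} [TopologicalSpace X] (O : Set (Set X)) : Prop :=
  (∀ U ∈ O, IsOpen U) ∧ ⋃₀ O = Set.univ

/-- `O'` refines `O`: every element of `O'` is contained in some element of `O`. -/
def Refines {X : Type*} (O' O : Set (Set X)) : Prop :=
  ∀ U ∈ O', ∃ V ∈ O, U ⊆ V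

/-- `O'` is a super-refinement of `O` (written `O' ≪ O`) if every point `x` has a *parent*:
an element of `O` containing every member of `O'` that contains `x`. -/
def SuperRefines {X : Type*} (O' O : Set (Set X)) : Prop :=
  ∀ x : X, ∃ U ∈ O, ∀ V ∈ O', x ∈ V → V ⊆ U

/-- A subset is `O`-tiny if it is contained in a single element of `O`. -/
def Tiny {X : Type*} (O : Set (Set X)) (A : Set X) : Prop :=
  ∃ U ∈ O, A ⊆ U

/-- A discrete chain is `O`-fine if each of its simplices is `O`-tiny. -/
def FineChain {X : Type*} (O : Set (Set X)) {m : ℕ} (c : DChain X m) : Prop :=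
  ∀ σ ∈ c.support, Tiny O (Set.range σ)

/-- A chain of tuples of sets is a nerve chain of the cover `O` if each of its simplices is a
tuple of elements of `O` with nonempty intersection. -/
def NerveChain {X : Type*} (O : Set (Set X)) {m : ℕ} (c : DChain (Set X) m) : Prop :=
  ∀ τ ∈ c.support, (∀ i, τ i ∈ O) ∧ (⋂ i, τ i).Nonempty

/-- `X` is super-refinable: every open cover admits a super-refinement. -/
def SuperRefinable (X : Type*) [TopologicalSpace X] : Prop :=
  ∀ O : Set (Set X), IsOpenCover O → ∃ O' : Set (Set X), IsOpenCover O' ∧ SuperRefines O' O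

/-- Condition `(DA_n)`: every open cover `O` has a refinement `O'` such that every `O'`-fine
discrete `n`-cycle is the boundary of an `O`-fine discrete `(n+1)`-chain. -/
def DA (X : Type*) [TopologicalSpace X] (n : ℕ) : Prop :=
  ∀ O : Set (Set X), IsOpenCover O →
    ∃ O' : Set (Set X), IsOpenCover O' ∧ Refines O' O ∧
      ∀ c : DChain X (n + 1), FineChain O' c → dbd c = 0 →
        ∃ d : DChain X (n + 2), FineChain O d ∧ dbd d = c

/-- Vanishing of the Čech cohomology `Ȟⁿ(X, A)`, i.e. of the direct limit over the directed
set of open covers of the cohomology of the nerves: every degree-`n` cocycle on the nerve of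
any open cover `O` pulls back, under (any) spouse map from a suitable refinement `O'`, to a
coboundary on the nerve of `O'`.  (Cochains on the nerve of `O` in degree `n` are
represented by functions on `(n+1)`-tuples of sets; only values on tuples of elements of `O`
with nonempty intersection matter.) -/
def CechCohomologyVanishes (X : Type*) [TopologicalSpace X] (n : ℕ) (A : Type*)
    [AddCommGroup A] : Prop :=
  ∀ O : Set (Set X), IsOpenCover O →
    ∀ φ : (Fin (n + 1) → Set X) → A,
      (∀ τ : Fin (n + 2) → Set X, (∀ i, τ i ∈ O) → (⋂ i, τ i).Nonempty →
        ∑ i : Fin (n + 2), ((-1 : ℤ) ^ (i : ℕ)) • φ (τ ∘ i.succAbove) = 0) →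
      ∃ O' : Set (Set X), IsOpenCover O' ∧ Refines O' O ∧
        ∀ f : Set X → Set X, (∀ U ∈ O', U ⊆ f U ∧ f U ∈ O) →
          ∃ ψ : (Fin n → Set X) → A,
            ∀ τ : Fin (n + 1) → Set X, (∀ i, τ i ∈ O') → (⋂ i, τ i).Nonempty →
              φ (fun j => f (τ j)) =
                ∑ i : Fin (n + 1), ((-1 : ℤ) ^ (i : ℕ)) • ψ (τ ∘ i.succAbove)

theorem dface_single {α : Type*} {m : ℕ} (i : Fin (m + 1)) (σ : Fin (m + 1) → α) (a : ℤ) :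
    dface i (Finsupp.single σ a) = Finsupp.single (σ ∘ i.succAbove) a := by
  simp [dface, Finsupp.mapDomain_single]

theorem dbd_single {α : Type*} {m : ℕ} (σ : Fin (m + 1) → α) :
    dbd (Finsupp.single σ 1) =
      ∑ i : Fin (m + 1), ((-1 : ℤ) ^ (i : ℕ)) • Finsupp.single (σ ∘ i.succAbove) (1 : ℤ) := by
  simp only [dbd, LinearMap.sum_apply, LinearMap.smul_apply, dface_single]

theorem vmap_single {α β : Type*} (f : α → β) {m : ℕ} (σ : Fin m → α) (a : ℤ) :
    vmap f (Finsupp.single σ a) = Finsupp.single (f ∘ σ) a := by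
  simp [vmap, Finsupp.mapDomain_single]

/-- The cone with apex `v`, prepending `v` to every simplex. -/
noncomputable def dcone {α : Type*} (v : α) {m : ℕ} : DChain α m →ₗ[ℤ] DChain α (m + 1) :=
  Finsupp.lmapDomain ℤ ℤ (fun σ => (Fin.cons v σ : Fin (m + 1) → α))

theorem dcone_single {α : Type*} (v : α) {m : ℕ} (σ : Fin m → α) (a : ℤ) :
    dcone v (Finsupp.single σ a) = Finsupp.single (Fin.cons v σ : Fin (m + 1) → α) a := by
  simp [dcone, Finsupp.mapDomain_single]

theorem dbd_dcone {α : Type*} (v : α) {m : ℕ} (c : DChain α (m + 1)) :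
    dbd (dcone v c) = c - dcone v (dbd c) := by
  suffices h : dbd ∘ₗ dcone v = LinearMap.id - dcone v ∘ₗ dbd (α := α) (m := m) from
    LinearMap.congr_fun h c
  refine Finsupp.lhom_ext' fun σ => LinearMap.ext_ring ?_
  have h0 : (Fin.cons v σ : Fin (m + 2) → α) ∘ Fin.succAbove 0 = σ := by
    ext j; simp
  have hs (i : Fin (m + 1)) : (Fin.cons v σ : Fin (m + 2) → α) ∘ i.succ.succAbove =
      (Fin.cons v (σ ∘ i.succAbove) : Fin (m + 1) → α) := by
    ext j
    refine Fin.cases ?_ (fun k => ?_) j <;> simp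
  simp only [LinearMap.comp_apply, Finsupp.lsingle_apply, LinearMap.sub_apply, LinearMap.id_apply,
    dcone_single, dbd_single, map_sum, map_smul]
  rw [Fin.sum_univ_succ, h0, sub_eq_add_neg, ← Finset.sum_neg_distrib]
  simp [hs, pow_succ]

theorem dbd_dcone_zero {α : Type*} (v : α) (c : DChain α 0) : dbd (dcone v c) = c := by
  suffices h : dbd ∘ₗ dcone v = (LinearMap.id : DChain α 0 →ₗ[ℤ] DChain α 0) from
    LinearMap.congr_fun h c
  refine Finsupp.lhom_ext' fun σ => LinearMap.ext_ring ?_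
  simp [dcone_single, dbd_single]

theorem single_eq_dcone {α : Type*} {m : ℕ} (σ : Fin (m + 1) → α) (a : ℤ) :
    Finsupp.single σ a = dcone (σ 0) (Finsupp.single (Fin.tail σ) a) := by
  rw [dcone_single, Fin.cons_self_tail]

theorem dbd_dbd {α : Type*} {m : ℕ} (c : DChain α (m + 2)) : dbd (dbd c) = 0 := by
  induction m with
  | zero =>
    suffices h : dbd ∘ₗ dbd (α := α) (m := 1) = 0 from LinearMap.congr_fun h c
    refine Finsupp.lhom_ext' fun σ => LinearMap.ext_ring ?_
    simp only [LinearMap.comp_apply, Finsupp.lsingle_apply, LinearMap.zero_apply]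
    rw [single_eq_dcone, dbd_dcone, map_sub, dbd_dcone_zero, sub_self]
  | succ m ih =>
    suffices h : dbd ∘ₗ dbd (α := α) (m := m + 2) = 0 from LinearMap.congr_fun h c
    refine Finsupp.lhom_ext' fun σ => LinearMap.ext_ring ?_
    simp only [LinearMap.comp_apply, Finsupp.lsingle_apply, LinearMap.zero_apply]
    rw [single_eq_dcone, dbd_dcone, map_sub, dbd_dcone, ih, map_zero, sub_zero, sub_self]

/-- The prism operator between two vertex maps, on a single simplex. -/
noncomputable def prismSimplex {α β : Type*} (f g : α → β) :
    (m : ℕ) → (Fin m → α) → DChain β (m + 1)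
  | 0, _ => 0
  | m + 1, σ => dcone (f (σ 0)) (Finsupp.single (g ∘ σ) 1 - prismSimplex f g m (Fin.tail σ))

/-- The prism operator, a chain homotopy between the chain maps of two vertex maps. -/
noncomputable def prism {α β : Type*} (f g : α → β) (m : ℕ) :
    DChain α m →ₗ[ℤ] DChain β (m + 1) :=
  Finsupp.linearCombination ℤ (prismSimplex f g m)

theorem prism_dcone {α β : Type*} (f g : α → β) {m : ℕ} (v : α) (c : DChain α m) :
    prism f g (m + 1) (dcone v c) = dcone (f v) (vmap g (dcone v c) - prism f g m c) := by
  suffices h : prism f g (m + 1) ∘ₗ dcone v =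
      dcone (f v) ∘ₗ (vmap g ∘ₗ dcone v - prism f g m) from LinearMap.congr_fun h c
  refine Finsupp.lhom_ext' fun σ => LinearMap.ext_ring ?_
  simp [prism, dcone_single, vmap_single, prismSimplex]

theorem vmap_dcone {α β : Type*} (f : α → β) {m : ℕ} (v : α) (c : DChain α m) :
    vmap f (dcone v c) = dcone (f v) (vmap f c) := by
  suffices h : vmap f ∘ₗ dcone v = dcone (f v) ∘ₗ vmap f (m := m) from LinearMap.congr_fun h c
  refine Finsupp.lhom_ext' fun σ => LinearMap.ext_ring ?_
  simp only [LinearMap.comp_apply, Finsupp.lsingle_apply, dcone_single, vmap_single]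
  congr 1
  ext j
  refine Fin.cases ?_ (fun k => ?_) j <;> simp

theorem dbd_vmap {α β : Type*} (f : α → β) {m : ℕ} (c : DChain α (m + 1)) :
    dbd (vmap f c) = vmap f (dbd c) := by
  suffices h : dbd ∘ₗ vmap f = vmap f ∘ₗ dbd (m := m) from LinearMap.congr_fun h c
  refine Finsupp.lhom_ext' fun σ => LinearMap.ext_ring ?_
  simp [dbd_single, vmap_single, Function.comp_assoc]

theorem dbd_prism {α β : Type*} (f g : α → β) {m : ℕ} (c : DChain α (m + 1)) :
    dbd (prism f g (m + 1) c) = vmap g c - vmap f c - prism f g m (dbd c) := by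
  induction m with
  | zero =>
    suffices h : dbd ∘ₗ prism f g 1 = vmap g - vmap f - prism f g 0 ∘ₗ dbd from
      LinearMap.congr_fun h c
    refine Finsupp.lhom_ext' fun σ => LinearMap.ext_ring ?_
    have h0 (c : DChain α 0) : prism f g 0 c = 0 := by
      simp [prism, Finsupp.linearCombination_apply, prismSimplex]
    have h1 (c : DChain α 0) : vmap g c = vmap f c := by
      unfold vmap
      congr 2
      ext σ i
      exact i.elim0
    simp only [LinearMap.comp_apply, Finsupp.lsingle_apply, LinearMap.sub_apply]
    rw [single_eq_dcone, prism_dcone, dbd_dcone, dbd_dcone_zero, map_sub, dbd_vmap,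
      dbd_dcone_zero, h0, map_zero, h1, vmap_dcone f]
    simp
  | succ m ih =>
    suffices h : dbd ∘ₗ prism f g (m + 2) = vmap g - vmap f - prism f g (m + 1) ∘ₗ dbd from
      LinearMap.congr_fun h c
    refine Finsupp.lhom_ext' fun σ => LinearMap.ext_ring ?_
    simp only [LinearMap.comp_apply, Finsupp.lsingle_apply, LinearMap.sub_apply]
    rw [single_eq_dcone, prism_dcone, dbd_dcone, dbd_dcone, map_sub dbd, ih, dbd_vmap, dbd_dcone,
      map_sub (prism f g (m + 1)), prism_dcone, vmap_dcone f]
    simp only [map_sub]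
    abel

theorem dcone_mem_supported {α : Type*} (v : α) {m : ℕ} {S : Set (Fin m → α)}
    {T : Set (Fin (m + 1) → α)} (h : ∀ σ ∈ S, (Fin.cons v σ : Fin (m + 1) → α) ∈ T)
    {c : DChain α m} (hc : c ∈ Finsupp.supported ℤ ℤ S) :
    dcone v c ∈ Finsupp.supported ℤ ℤ T := by
  rw [Finsupp.supported_eq_span_single] at hc
  refine (Submodule.span_le (p := (Finsupp.supported ℤ ℤ T).comap (dcone v))).2 ?_ hc
  rintro _ ⟨σ, hσ, rfl⟩
  simpa only [SetLike.mem_coe, Submodule.mem_comap, dcone_single] using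
    Finsupp.single_mem_supported ℤ _ (h σ hσ)

theorem prismSimplex_mem_supported {α β : Type*} (f g : α → β) (m : ℕ) (σ : Fin m → α) :
    prismSimplex f g m σ ∈
      Finsupp.supported ℤ ℤ {τ | ∀ i, ∃ j, τ i = f (σ j) ∨ τ i = g (σ j)} := by
  induction m with
  | zero => exact Submodule.zero_mem _
  | succ m ih =>
    have hmem : Finsupp.single (g ∘ σ) 1 - prismSimplex f g m (Fin.tail σ) ∈
        Finsupp.supported ℤ ℤ {τ | ∀ i, ∃ j, τ i = f (σ j) ∨ τ i = g (σ j)} := by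
      refine Submodule.sub_mem _ (Finsupp.single_mem_supported ℤ _ fun i => ⟨i, Or.inr rfl⟩) ?_
      refine Finsupp.supported_mono ?_ (ih (Fin.tail σ))
      exact fun τ hτ i => (hτ i).imp' Fin.succ fun _ h => h
    refine dcone_mem_supported (f (σ 0)) (fun τ hτ i => ?_) hmem
    exact Fin.cases ⟨0, Or.inl rfl⟩ (fun j => by simpa using hτ j) i

theorem fineChain_iff {X : Type*} {O : Set (Set X)} {m : ℕ} {c : DChain X m} :
    FineChain O c ↔ c ∈ Finsupp.supported ℤ ℤ {σ | Tiny O (Set.range σ)} :=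
  Iff.rfl

theorem Tiny.mono {X : Type*} {O : Set (Set X)} {A B : Set X} (hB : Tiny O B) (h : A ⊆ B) :
    Tiny O A :=
  let ⟨U, hU, hBU⟩ := hB
  ⟨U, hU, h.trans hBU⟩

theorem Tiny.refines {X : Type*} [TopologicalSpace X] {O O' : Set (Set X)} {A : Set X}
    (hA : Tiny O' A) (h : Refines O' O) : Tiny O A :=
  let ⟨_, hU, hAU⟩ := hA
  let ⟨V, hV, hUV⟩ := h _ hU
  ⟨V, hV, hAU.trans hUV⟩

theorem fineChain_single {X : Type*} {O : Set (Set X)} {m : ℕ} {σ : Fin m → X}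
    (h : Tiny O (Set.range σ)) (a : ℤ) : FineChain O (Finsupp.single σ a) :=
  fineChain_iff.2 (Finsupp.single_mem_supported ℤ _ h)

theorem fineChain_dbd_single {X : Type*} {O : Set (Set X)} {m : ℕ} {σ : Fin (m + 1) → X}
    (h : Tiny O (Set.range σ)) : FineChain O (dbd (Finsupp.single σ 1)) := by
  rw [fineChain_iff, dbd_single]
  exact Submodule.sum_mem _ fun i _ => Submodule.smul_mem _ _ <|
    Finsupp.single_mem_supported ℤ _ (h.mono (Set.range_comp_subset_range _ _))

theorem linearCombination_dbd_single {α A : Type*} [AddCommGroup A] {m : ℕ}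
    (φ : (Fin m → α) → A) (σ : Fin (m + 1) → α) :
    Finsupp.linearCombination ℤ φ (dbd (Finsupp.single σ 1)) =
      ∑ i : Fin (m + 1), ((-1 : ℤ) ^ (i : ℕ)) • φ (σ ∘ i.succAbove) := by
  simp [dbd_single]

theorem linearCombination_dbd_eq_zero {α A : Type*} [AddCommGroup A] {m : ℕ}
    (φ : (Fin m → α) → A) (S : Set (Fin (m + 1) → α))
    (hφ : ∀ σ ∈ S, ∑ i : Fin (m + 1), ((-1 : ℤ) ^ (i : ℕ)) • φ (σ ∘ i.succAbove) = 0)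
    {c : DChain α (m + 1)} (hc : c ∈ Finsupp.supported ℤ ℤ S) :
    Finsupp.linearCombination ℤ φ (dbd c) = 0 := by
  rw [Finsupp.supported_eq_span_single] at hc
  refine (Submodule.span_le (p := LinearMap.ker (Finsupp.linearCombination ℤ φ ∘ₗ dbd))).2 ?_ hc
  rintro _ ⟨σ, hσ, rfl⟩
  simpa [linearCombination_dbd_single] using hφ σ hσ

theorem Submodule.free_of_finsupp_of_isPrincipalIdealRing {R ι : Type*} [CommRing R] [IsDomain R]
    [IsPrincipalIdealRing R] (N : Submodule R (ι →₀ R)) : Module.Free R N := by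
  obtain ⟨_, _⟩ := exists_wellFoundedLT ι
  let lead (i : ι) : Ideal R :=
    (N ⊓ Finsupp.supported R R (Set.Iic i)).map (Finsupp.lapply i)
  let c (i : ι) : R := Submodule.IsPrincipal.generator (lead i)
  have hc (i : ι) : ∃ x ∈ N ⊓ Finsupp.supported R R (Set.Iic i), x i = c i :=
    Submodule.mem_map.1 (Submodule.IsPrincipal.generator_mem (lead i))
  choose x hx hxc using hc
  let v (i : {i // c i ≠ 0}) : N := ⟨x i, (hx i).1⟩
  have hspan (i : ι) : ∀ y (hy : y ∈ N), y ∈ Finsupp.supported R R (Set.Iic i) →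
      (⟨y, hy⟩ : N) ∈ Submodule.span R (Set.range v) := by
    induction i using WellFoundedLT.induction with
    | ind i ih =>
      intro y hy hyi
      obtain ⟨a, ha⟩ := (Submodule.IsPrincipal.mem_iff_eq_smul_generator (lead i)).1
        (Submodule.mem_map_of_mem (f := Finsupp.lapply i) ⟨hy, hyi⟩)
      change y i = a • c i at ha
      have hlower (z) (hz : z ∈ N) (hzi : z ∈ Finsupp.supported R R (Set.Iic i)) (h0 : z i = 0) :
          (⟨z, hz⟩ : N) ∈ Submodule.span R (Set.range v) := by
        by_cases hz0 : z = 0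
        · subst hz0
          exact Submodule.zero_mem _
        · have hmem := Finset.max'_mem _ (Finsupp.support_nonempty_iff.2 hz0)
          refine ih _ (lt_of_le_of_ne (hzi hmem) fun h => ?_) z hz
            fun j hj => Finset.le_max' _ _ hj
          rw [h, Finsupp.mem_support_iff] at hmem
          exact hmem h0
      by_cases hci : c i = 0
      · exact hlower y hy hyi (by rw [ha, hci, smul_zero])
      · have hzN : y - a • x i ∈ N := N.sub_mem hy (N.smul_mem a (hx i).1)
        have hzspan := hlower _ hzN
          (Submodule.sub_mem _ hyi (Submodule.smul_mem _ a (hx i).2)) (by simp [ha, hxc])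
        have hsum : (⟨y, hy⟩ : N) = ⟨y - a • x i, hzN⟩ + a • v ⟨i, hci⟩ := by
          ext1
          simp [v]
        rw [hsum]
        exact Submodule.add_mem _ hzspan
          (Submodule.smul_mem _ _ (Submodule.subset_span (Set.mem_range_self _)))
  have hli : LinearIndependent R v := by
    refine LinearIndependent.of_comp N.subtype (linearIndependent_iff.2 fun l hl => ?_)
    by_contra hl0
    have hmem := Finset.max'_mem _ (Finsupp.support_nonempty_iff.2 hl0)
    set j := l.support.max' (Finsupp.support_nonempty_iff.2 hl0) with hj
    have heval := DFunLike.congr_fun hl (j : ι)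
    rw [Finsupp.linearCombination_apply, Finsupp.sum, Finsupp.finsetSum_apply, Finset.sum_eq_single j] at heval
    · simp only [v, Function.comp_apply, Submodule.subtype_apply, Finsupp.smul_apply, hxc,
        Finsupp.coe_zero, Pi.zero_apply, smul_eq_mul] at heval
      exact (mul_ne_zero (Finsupp.mem_support_iff.1 hmem) j.2) heval
    · intro i hi hij
      have hlt : i < j := lt_of_le_of_ne (Finset.le_max' _ _ hi) hij
      have hzero : x i j = 0 := by
        by_contra h
        exact not_le_of_gt hlt ((hx i).2 (Finsupp.mem_support_iff.2 h))
      simp [v, hzero]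
    · exact fun h => absurd hmem h
  refine Module.Free.of_basis (Module.Basis.mk hli ?_)
  rintro ⟨y, hy⟩ -
  by_cases hy0 : y = 0
  · subst hy0
    exact Submodule.zero_mem _
  · exact hspan (y.support.max' (Finsupp.support_nonempty_iff.2 hy0)) y hy
      fun j hj => Finset.le_max' _ _ hj

theorem Submodule.free_of_free_of_isPrincipalIdealRing {R M : Type*} [CommRing R] [IsDomain R]
    [IsPrincipalIdealRing R] [AddCommGroup M] [Module R M] [Module.Free R M]
    (N : Submodule R M) : Module.Free R N := by
  let e := (Module.Free.chooseBasis R M).repr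
  have := Submodule.free_of_finsupp_of_isPrincipalIdealRing (N.map e.toLinearMap)
  exact Module.Free.of_equiv (e.submoduleMap N).symm

theorem exists_retraction_ker {M F : Type*} [AddCommGroup M] [AddCommGroup F] [Module.Free ℤ F]
    (D : M →ₗ[ℤ] F) :
    ∃ r : M →ₗ[ℤ] M, (∀ x, D (r x) = 0) ∧ ∀ x, D x = 0 → r x = x := by
  have := Submodule.free_of_free_of_isPrincipalIdealRing (LinearMap.range D)
  obtain ⟨s, hs⟩ := Module.projective_lifting_property D.rangeRestrict LinearMap.id
    D.surjective_rangeRestrict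
  have hs' (y) : D (s y) = y := congrArg Subtype.val (LinearMap.congr_fun hs y)
  refine ⟨LinearMap.id - s ∘ₗ D.rangeRestrict, fun x => ?_, fun x hx => ?_⟩
  · simp [hs']
  · have : D.rangeRestrict x = 0 := Subtype.ext hx
    simp [this]

theorem exists_filling_operator_zero {X : Type*} (U : Set (Set X)) :
    ∃ E : DChain X 1 →ₗ[ℤ] DChain X 2, (∀ c, FineChain U (E c)) ∧
      ∀ τ : Fin 2 → X, Tiny U (Set.range τ) →
        dbd (E (dbd (Finsupp.single τ 1))) = dbd (Finsupp.single τ 1) := by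
  let r : (Fin 1 → X) → (Fin 1 → X) → Prop := fun a b => Tiny U {a 0, b 0}
  have hfill (a b : Fin 1 → X) (hab : Relation.EqvGen r a b) : ∃ d : DChain X 2, FineChain U d ∧
      dbd d = Finsupp.single b 1 - Finsupp.single a 1 := by
    induction hab with
    | rel a b h =>
      refine ⟨Finsupp.single ![a 0, b 0] 1, fineChain_single (by simpa [r, Set.pair_comm] using h) 1, ?_⟩
      have h0 : ![a 0, b 0] ∘ Fin.succAbove 0 = b := by ext j; fin_cases j; rfl
      have h1 : ![a 0, b 0] ∘ Fin.succAbove 1 = a := by ext j; fin_cases j; rfl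
      rw [dbd_single, Fin.sum_univ_two, h0, h1]
      simp [sub_eq_add_neg]
    | refl a => exact ⟨0, fineChain_iff.2 (Submodule.zero_mem _), by simp⟩
    | symm a b _ ih =>
      obtain ⟨d, hd, h⟩ := ih
      exact ⟨-d, fineChain_iff.2 (Submodule.neg_mem _ hd), by simp [h]⟩
    | trans a b c _ _ ih₁ ih₂ =>
      obtain ⟨d, hd, h⟩ := ih₁
      obtain ⟨d', hd', h'⟩ := ih₂
      exact ⟨d + d', fineChain_iff.2 (Submodule.add_mem _ hd hd'), by simp [h, h']⟩
  let base : (Fin 1 → X) → (Fin 1 → X) := fun a => (Quot.mk r a).out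
  have hbase (a) : Relation.EqvGen r (base a) a := Quot.eqvGen_exact (Quot.out_eq _)
  choose d hd hdbd using fun a => hfill _ _ (hbase a)
  refine ⟨Finsupp.linearCombination ℤ d, fun c => fineChain_iff.2 ?_, fun τ hτ => ?_⟩
  · rw [Finsupp.linearCombination_apply]
    exact Submodule.sum_mem _ fun σ _ => Submodule.smul_mem _ _ (hd σ)
  · have hb : base (τ ∘ Fin.succAbove 0) = base (τ ∘ Fin.succAbove 1) := by
      have h : r (τ ∘ Fin.succAbove 0) (τ ∘ Fin.succAbove 1) := by
        refine hτ.mono ?_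
        rintro x (rfl | rfl) <;> exact Set.mem_range_self _
      exact congrArg Quot.out (Quot.sound h)
    rw [linearCombination_dbd_single, dbd_single, Fin.sum_univ_two, Fin.sum_univ_two]
    simp only [map_add, map_smul, hdbd, hb]
    simp
    abel

theorem exists_filling_operator_succ {X : Type*} [TopologicalSpace X] {k : ℕ}
    (h : DA X (k + 1)) {U : Set (Set X)} (hU : IsOpenCover U) :
    ∃ O : Set (Set X), IsOpenCover O ∧ Refines O U ∧
      ∃ E : DChain X (k + 2) →ₗ[ℤ] DChain X (k + 3), (∀ c, FineChain U (E c)) ∧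
        ∀ τ : Fin (k + 3) → X, Tiny O (Set.range τ) →
          dbd (E (dbd (Finsupp.single τ 1))) = dbd (Finsupp.single τ 1) := by
  obtain ⟨O, hO, hOU, hfill⟩ := h U hU
  refine ⟨O, hO, hOU, ?_⟩
  let W : Submodule ℤ (DChain X (k + 2)) := Finsupp.supported ℤ ℤ {σ | Tiny O (Set.range σ)}
  obtain ⟨r, hr0, hr⟩ := exists_retraction_ker (dbd ∘ₗ W.subtype)
  have hd (σ : Fin (k + 2) → X) : ∃ d : DChain X (k + 3), FineChain U d ∧
      ∀ hσ : Finsupp.single σ 1 ∈ W, dbd d = r ⟨Finsupp.single σ 1, hσ⟩ := by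
    by_cases hσ : Finsupp.single σ 1 ∈ W
    · obtain ⟨d, hd, hdbd⟩ := hfill _ (r ⟨_, hσ⟩).2 (hr0 ⟨_, hσ⟩)
      exact ⟨d, hd, fun _ => hdbd⟩
    · exact ⟨0, fineChain_iff.2 (Submodule.zero_mem _), fun h => absurd h hσ⟩
  choose d hd hdbd using hd
  refine ⟨Finsupp.linearCombination ℤ d, fun c => fineChain_iff.2 ?_, fun τ hτ => ?_⟩
  · rw [Finsupp.linearCombination_apply]
    exact Submodule.sum_mem _ fun σ _ => Submodule.smul_mem _ _ (hd σ)
  · have hface (i : Fin (k + 3)) : Finsupp.single (τ ∘ i.succAbove) 1 ∈ W :=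
      Finsupp.single_mem_supported ℤ _ (hτ.mono (Set.range_comp_subset_range _ _))
    have hsum : (⟨dbd (Finsupp.single τ 1), fineChain_dbd_single hτ⟩ : W) =
        ∑ i : Fin (k + 3), ((-1 : ℤ) ^ (i : ℕ)) • ⟨_, hface i⟩ := by
      ext1
      simp only [dbd_single, Submodule.coe_sum, Submodule.coe_smul]
    have hfix := hr ⟨dbd (Finsupp.single τ 1), fineChain_dbd_single hτ⟩ (dbd_dbd _)
    rw [hsum, map_sum] at hfix
    have hfix' := congrArg Subtype.val hfix
    rw [← hsum] at hfix'
    rw [linearCombination_dbd_single, map_sum]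
    refine Eq.trans ?_ hfix'
    simp only [map_smul, hdbd _ (hface _), Submodule.coe_sum, Submodule.coe_smul]

theorem exists_primitive_of_cocycle {X : Type*} [TopologicalSpace X] {k : ℕ}
    (hda : DA X (k + 1)) (hda' : 1 ≤ k → DA X k) {A : Type*} [AddCommGroup A]
    {O : Set (Set X)} (hO : IsOpenCover O) (φ : (Fin (k + 2) → X) → A)
    (hφ : ∀ σ : Fin (k + 3) → X, Tiny O (Set.range σ) →
      ∑ i : Fin (k + 3), ((-1 : ℤ) ^ (i : ℕ)) • φ (σ ∘ i.succAbove) = 0) :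
    ∃ O' : Set (Set X), IsOpenCover O' ∧ Refines O' O ∧ ∃ ψ : (Fin (k + 1) → X) → A,
      ∀ σ : Fin (k + 2) → X, Tiny O' (Set.range σ) →
        φ σ = ∑ i : Fin (k + 2), ((-1 : ℤ) ^ (i : ℕ)) • ψ (σ ∘ i.succAbove) := by
  obtain ⟨U, hU, hUO, hfill⟩ := hda O hO
  obtain ⟨O', hO', hO'U, E, hE, hEdbd⟩ : ∃ O' : Set (Set X), IsOpenCover O' ∧ Refines O' U ∧
      ∃ E : DChain X (k + 1) →ₗ[ℤ] DChain X (k + 2), (∀ c, FineChain U (E c)) ∧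
        ∀ τ : Fin (k + 2) → X, Tiny O' (Set.range τ) →
          dbd (E (dbd (Finsupp.single τ 1))) = dbd (Finsupp.single τ 1) := by
    cases k with
    | zero => exact ⟨U, hU, fun V hV => ⟨V, hV, subset_rfl⟩, exists_filling_operator_zero U⟩
    | succ k => exact exists_filling_operator_succ (hda' (by omega)) hU
  refine ⟨O', hO', fun V hV => ?_,
    fun σ => Finsupp.linearCombination ℤ φ (E (Finsupp.single σ 1)), fun σ hσ => ?_⟩
  · obtain ⟨V', hV', hVV'⟩ := hO'U V hV
    exact (hUO V' hV').imp fun _ h => ⟨h.1, hVV'.trans h.2⟩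
  · obtain ⟨d, hd, hdbd⟩ := hfill (Finsupp.single σ 1 - E (dbd (Finsupp.single σ 1)))
      (fineChain_iff.2 (Submodule.sub_mem _ (fineChain_single (hσ.refines hO'U) 1) (hE _)))
      (by rw [map_sub, hEdbd σ hσ, sub_self])
    have h0 := linearCombination_dbd_eq_zero φ _ hφ hd
    rw [hdbd, map_sub, sub_eq_zero, Finsupp.linearCombination_single, one_smul] at h0
    rw [h0, dbd_single]
    simp only [map_sum, map_smul]

theorem SuperRefines.refines {X : Type*} [TopologicalSpace X] [Nonempty X] {O' O : Set (Set X)}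
    (h : SuperRefines O' O) : Refines O' O := by
  intro V hV
  rcases V.eq_empty_or_nonempty with rfl | ⟨x, hx⟩
  · obtain ⟨U, hU, -⟩ := h (Classical.arbitrary X)
    exact ⟨U, hU, Set.empty_subset _⟩
  · obtain ⟨U, hU, hVU⟩ := h x
    exact ⟨U, hU, hVU V hV hx⟩

theorem cochain_sub_eq_coboundary_of_spouses {X : Type*} {A : Type*} [AddCommGroup A] {n : ℕ}
    {O : Set (Set X)} (φ : (Fin (n + 1) → Set X) → A)
    (hφ : ∀ τ : Fin (n + 2) → Set X, (∀ i, τ i ∈ O) → (⋂ i, τ i).Nonempty →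
      ∑ i : Fin (n + 2), ((-1 : ℤ) ^ (i : ℕ)) • φ (τ ∘ i.succAbove) = 0)
    (f g : Set X → Set X) (τ : Fin (n + 1) → Set X) (hne : (⋂ i, τ i).Nonempty)
    (hf : ∀ i, τ i ⊆ f (τ i) ∧ f (τ i) ∈ O) (hg : ∀ i, τ i ⊆ g (τ i) ∧ g (τ i) ∈ O) :
    φ (g ∘ τ) - φ (f ∘ τ) = ∑ i : Fin (n + 1), ((-1 : ℤ) ^ (i : ℕ)) •
      Finsupp.linearCombination ℤ φ (prismSimplex f g n (τ ∘ i.succAbove)) := by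
  have h0 : Finsupp.linearCombination ℤ φ (dbd (prism f g (n + 1) (Finsupp.single τ 1))) = 0 := by
    refine linearCombination_dbd_eq_zero φ
      {ρ | ∀ i, ∃ j, ρ i = f (τ j) ∨ ρ i = g (τ j)} (fun ρ hρ => hφ ρ (fun i => ?_) ?_) ?_
    · obtain ⟨j, h | h⟩ := hρ i
      · exact h ▸ (hf j).2
      · exact h ▸ (hg j).2
    · obtain ⟨x, hx⟩ := hne
      rw [Set.mem_iInter] at hx
      refine ⟨x, Set.mem_iInter.2 fun i => ?_⟩
      obtain ⟨j, h | h⟩ := hρ i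
      · exact h ▸ (hf j).1 (hx j)
      · exact h ▸ (hg j).1 (hx j)
    · simpa [prism] using prismSimplex_mem_supported f g (n + 1) τ
  rw [dbd_prism, map_sub, sub_eq_zero] at h0
  simpa [vmap_single, dbd_single, prism] using h0

/-- Let `X` be a super-refinable topological space and `n ≥ 1`.  If `X`
satisfies `(DA_n)`, and additionally `(DA_{n-1})` in case `n ≥ 2`, then `Ȟⁿ(X,ℛ) = 0` for
every principal ideal domain `ℛ`. -/
theorem cech_cohomology_vanishes_PID {X : Type*} [TopologicalSpace X]
    (hsr : SuperRefinable X) (n : ℕ) (hn : 1 ≤ n)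
    (hda : DA X n) (hda' : 2 ≤ n → DA X (n - 1))
    (R : Type*) [CommRing R] [IsDomain R] [IsPrincipalIdealRing R] :
    CechCohomologyVanishes X n R := by
  intro O hO φ hφ
  obtain ⟨k, rfl⟩ : ∃ k, n = k + 1 := ⟨n - 1, by omega⟩
  rcases isEmpty_or_nonempty X with hX | hX
  · exact ⟨O, hO, fun V hV => ⟨V, hV, subset_rfl⟩, fun _ _ =>
      ⟨0, fun _ _ hne => (hX.false hne.some).elim⟩⟩
  obtain ⟨O₁, hO₁, hsr₁⟩ := hsr O hO
  choose p hpO hp using hsr₁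
  obtain ⟨O₂, hO₂, hO₂₁, ψ, hψ⟩ := exists_primitive_of_cocycle hda
    (fun hk => hda' (by omega)) hO₁ (fun σ => φ (p ∘ σ)) fun σ hσ => by
      obtain ⟨V, hV, hσV⟩ := hσ
      have hmem (i) : σ i ∈ V := hσV (Set.mem_range_self i)
      exact hφ (p ∘ σ) (fun i => hpO _) ⟨σ 0, Set.mem_iInter.2 fun i =>
        hp (σ i) V hV (hmem i) (hmem 0)⟩
  obtain ⟨O₃, hO₃, hsr₃⟩ := hsr O₂ hO₂
  have hspouse (V : Set X) (hV : V ∈ O₃) (x : X) (hx : x ∈ V) : V ⊆ p x := by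
    obtain ⟨V₂, hV₂, h₂⟩ := hsr₃.refines V hV
    obtain ⟨V₁, hV₁, h₁⟩ := hO₂₁ V₂ hV₂
    exact (h₂.trans h₁).trans (hp x V₁ hV₁ (h₁ (h₂ hx)))
  refine ⟨O₃, hO₃, fun V hV => ?_, fun f hf => ?_⟩
  · rcases V.eq_empty_or_nonempty with rfl | ⟨x, hx⟩
    · exact ⟨p (Classical.arbitrary X), hpO _, Set.empty_subset _⟩
    · exact ⟨p x, hpO x, hspouse V hV x hx⟩
  · have hs (V : Set X) : ∃ x : X, V.Nonempty → x ∈ V := by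
      by_cases h : V.Nonempty
      · exact ⟨h.some, fun _ => h.some_mem⟩
      · exact ⟨Classical.arbitrary X, fun h' => absurd h' h⟩
    choose s hs using hs
    refine ⟨fun ρ => ψ (s ∘ ρ) + Finsupp.linearCombination ℤ φ
      (prismSimplex (fun V => p (s V)) f (k + 1) ρ), fun τ hτ hne => ?_⟩
    have hsτ (i) : s (τ i) ∈ τ i := hs _ (hne.mono (Set.iInter_subset _ i))
    have hhom := cochain_sub_eq_coboundary_of_spouses φ hφ (fun V => p (s V)) f τ hne
      (fun i => ⟨hspouse _ (hτ i) _ (hsτ i), hpO _⟩) (fun i => hf _ (hτ i))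
    have hprim := hψ (s ∘ τ) (by
      obtain ⟨x, hx⟩ := hne
      rw [Set.mem_iInter] at hx
      obtain ⟨U, hU, hVU⟩ := hsr₃ x
      exact ⟨U, hU, Set.range_subset_iff.2 fun i => hVU _ (hτ i) (hx i) (hsτ i)⟩)
    simp only [smul_add, Finset.sum_add_distrib]
    rw [← hhom]
    exact (add_sub_cancel (φ (p ∘ s ∘ τ)) (φ (f ∘ τ))).symm.trans 
      (congrArg (· + (φ (f ∘ τ) - φ (p ∘ s ∘ τ))) hprim)
end

section
/- Assume the ball-system setup with filling hypotheses (F0), (F1) and (F2), and assume property (*). Assume moreover that (𝒮,ρ) is compact and that for every r > 0 only finitely many p ∈ P satisfy r_p ≥ r. For n ≥ 1 define the stratum X_n := 𝒮 − ⋃_{p∈P} {x ∈ 𝒮 : ρ(p,x) < r_p/(nM)}. Then there exist a function f_1 with f_1(n) ≥ n, a function g_1 with 0 < g_1(δ,n) ≤ δ, and a function 𝔥: ℝ⁺ → ℝ⁺ with 𝔥(r) → 0 as r → 0, such that for all δ > 0, n ≥ 1 and 0 ≤ i < k: every g_1(δ,n)-fine reduced discrete i-cycle c supported in X_n is the boundary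 of a δ-fine discrete chain d supported in X_{f_1(n)} with diam(d) ≤ 𝔥(diam(c)). -/
/-- A discrete chain is `δ`-fine if each of its simplices has diameter at most `δ`. -/
def FineLE {X : Type*} [PseudoMetricSpace X] {m : ℕ} (δ : ℝ) (c : DChain X m) : Prop :=
  ∀ σ ∈ c.support, Metric.diam (Set.range σ) ≤ δ

/-- The closed annulus `A(p; r₁, r₂)` around `p`. -/
def annulus {X : Type*} [PseudoMetricSpace X] (p : X) (r₁ r₂ : ℝ) : Set X :=
  {x | r₁ ≤ dist p x ∧ dist p x ≤ r₂}

/-- Filling hypothesis (F1): reduced `g(δ)`-fine discrete `i`-cycles (`0 ≤ i < k`) supported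
in an annulus `A(p; r₁, r₂)` with `δ ≤ r₁ < r₂ ≤ r_p/K` around a point `p ∈ P` bound
`δ`-fine chains in `A(p; r₁/K, K·r₂)` of diameter at most `K·√(diam c)`. -/
def FillAnnuli {𝒮 : Type*} [MetricSpace 𝒮] (k : ℕ) (K : ℝ) (g : ℝ → ℝ)
    (P : Set 𝒮) (r : 𝒮 → ℝ) : Prop :=
  ∀ p ∈ P, ∀ δ : ℝ, 0 < δ → ∀ i : ℕ, i < k → ∀ r₁ r₂ : ℝ, δ ≤ r₁ → r₁ < r₂ → r₂ ≤ r p / K →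
    ∀ c : DChain 𝒮 (i + 1), dbd c = 0 → FineLE (g δ) c → chainSupp c ⊆ annulus p r₁ r₂ →
      ∃ d : DChain 𝒮 (i + 2), dbd d = c ∧ FineLE δ d ∧
        chainSupp d ⊆ annulus p (r₁ / K) (K * r₂) ∧
        Metric.diam (chainSupp d) ≤ K * Real.sqrt (Metric.diam (chainSupp c))

/-- Filling hypothesis (F2): reduced `g(δ)`-fine discrete `i`-cycles (`0 ≤ i ≤ k`) supported
in a ball `B(p, r₂)` with `0 < r₂ ≤ r_p/K` around a point `p ∈ P` bound `δ`-fine chains in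
`B(p, K·r₂)` of diameter at most `K·√(diam c)`. -/
def FillBalls {𝒮 : Type*} [MetricSpace 𝒮] (k : ℕ) (K : ℝ) (g : ℝ → ℝ)
    (P : Set 𝒮) (r : 𝒮 → ℝ) : Prop :=
  ∀ p ∈ P, ∀ δ : ℝ, 0 < δ → ∀ i : ℕ, i ≤ k → ∀ r₂ : ℝ, 0 < r₂ → r₂ ≤ r p / K →
    ∀ c : DChain 𝒮 (i + 1), dbd c = 0 → FineLE (g δ) c →
      chainSupp c ⊆ Metric.closedBall p r₂ →
      ∃ d : DChain 𝒮 (i + 2), dbd d = c ∧ FineLE δ d ∧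
        chainSupp d ⊆ Metric.closedBall p (K * r₂) ∧
        Metric.diam (chainSupp d) ≤ K * Real.sqrt (Metric.diam (chainSupp c))

/-- Filling hypothesis (F0): every reduced `g(δ)`-fine discrete `i`-cycle (`0 ≤ i ≤ k`) in
`𝒮` bounds a `δ`-fine chain of diameter at most `K·√(diam c)`. -/
def FillAll {𝒮 : Type*} [MetricSpace 𝒮] (k : ℕ) (K : ℝ) (g : ℝ → ℝ) : Prop :=
  ∀ δ : ℝ, 0 < δ → ∀ i : ℕ, i ≤ k →
    ∀ c : DChain 𝒮 (i + 1), dbd c = 0 → FineLE (g δ) c →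
      ∃ d : DChain 𝒮 (i + 2), dbd d = c ∧ FineLE δ d ∧
        Metric.diam (chainSupp d) ≤ K * Real.sqrt (Metric.diam (chainSupp c))

namespace DChain

variable {α : Type*} {m : ℕ}

theorem mem_chainSupp {c : DChain α m} {x : α} :
    x ∈ chainSupp c ↔ ∃ σ ∈ c.support, ∃ j, σ j = x := by
  simp only [chainSupp, Set.mem_iUnion, Set.mem_range, exists_prop]

theorem finite_chainSupp (c : DChain α m) : (chainSupp c).Finite :=
  c.support.finite_toSet.biUnion fun σ _ => Set.finite_range σ

theorem chainSupp_add_subset (c d : DChain α m) :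
    chainSupp (c + d) ⊆ chainSupp c ∪ chainSupp d := by
  classical
  intro x hx
  obtain ⟨σ, hσ, j, rfl⟩ := mem_chainSupp.1 hx
  rcases Finset.mem_union.1 (Finsupp.support_add hσ) with h | h
  · exact Or.inl (mem_chainSupp.2 ⟨σ, h, j, rfl⟩)
  · exact Or.inr (mem_chainSupp.2 ⟨σ, h, j, rfl⟩)

theorem exists_of_mem_support_dbd {d : DChain α (m + 1)} {σ : Fin m → α}
    (h : σ ∈ (dbd d).support) : ∃ τ ∈ d.support, ∃ i : Fin (m + 1), τ ∘ i.succAbove = σ := by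
  classical
  rw [Finsupp.mem_support_iff, dbd, LinearMap.sum_apply, Finsupp.finsetSum_apply] at h
  obtain ⟨i, -, hi⟩ := Finset.exists_ne_zero_of_sum_ne_zero h
  have hi' : (dface i d) σ ≠ 0 := by
    intro h0
    apply hi
    rw [LinearMap.smul_apply, Finsupp.smul_apply, h0, smul_zero]
  have hm : σ ∈ (Finsupp.mapDomain (fun τ : Fin (m + 1) → α => τ ∘ i.succAbove) d).support :=
    Finsupp.mem_support_iff.2 hi'
  obtain ⟨τ, hτ, hτσ⟩ := Finset.mem_image.1 (Finsupp.mapDomain_support hm)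
  exact ⟨τ, hτ, i, hτσ⟩

theorem chainSupp_dbd_subset (d : DChain α (m + 1)) : chainSupp (dbd d) ⊆ chainSupp d := by
  intro x hx
  obtain ⟨σ, hσ, j, rfl⟩ := mem_chainSupp.1 hx
  obtain ⟨τ, hτ, i, rfl⟩ := exists_of_mem_support_dbd hσ
  exact mem_chainSupp.2 ⟨τ, hτ, _, rfl⟩

theorem dface_single (i : Fin (m + 1)) (σ : Fin (m + 1) → α) (a : ℤ) :
    dface i (Finsupp.single σ a) = Finsupp.single (σ ∘ i.succAbove) a :=
  Finsupp.mapDomain_single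

theorem vmap_single {β : Type*} (f : α → β) (σ : Fin m → α) (a : ℤ) :
    vmap f (Finsupp.single σ a) = Finsupp.single (f ∘ σ) a :=
  Finsupp.mapDomain_single

theorem dbd_single (σ : Fin (m + 1) → α) (a : ℤ) :
    dbd (Finsupp.single σ a) =
      ∑ i : Fin (m + 1), ((-1 : ℤ) ^ (i : ℕ)) • Finsupp.single (σ ∘ i.succAbove) a := by
  simp only [dbd, LinearMap.sum_apply, LinearMap.smul_apply, dface_single]

theorem dbd_single_edge (σ : Fin 2 → α) (a : ℤ) :
    dbd (Finsupp.single σ a : DChain α 2) =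
      (Finsupp.single (fun _ => σ 1) a - Finsupp.single (fun _ => σ 0) a : DChain α 1) := by
  have h0 : σ ∘ (0 : Fin 2).succAbove = fun _ => σ 1 := by
    funext j
    rw [Subsingleton.elim j 0]
    rfl
  have h1 : σ ∘ (1 : Fin 2).succAbove = fun _ => σ 0 := by
    funext j
    rw [Subsingleton.elim j 0]
    rfl
  rw [dbd_single, Fin.sum_univ_two, h0, h1]
  simp [sub_eq_add_neg]

theorem dbd_vmap {β : Type*} (f : α → β) (d : DChain α (m + 1)) :
    dbd (vmap f d) = vmap f (dbd d) := by
  induction d using Finsupp.induction_linear with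
  | zero => simp
  | add x y hx hy => simp only [map_add, hx, hy]
  | single σ a =>
    simp only [vmap_single, dbd_single, map_sum, map_smul, Function.comp_assoc]

theorem vmap_eq_self {f : α → α} {c : DChain α m} (h : ∀ x ∈ chainSupp c, f x = x) :
    vmap f c = c := by
  have : vmap f c = Finsupp.mapDomain id c := by
    refine Finsupp.mapDomain_congr fun σ hσ => ?_
    funext j
    exact h _ (mem_chainSupp.2 ⟨σ, hσ, j, rfl⟩)
  rw [this, Finsupp.mapDomain_id]

theorem exists_of_mem_support_vmap {β : Type*} {f : α → β} {c : DChain α m} {τ : Fin m → β}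
    (h : τ ∈ (vmap f c).support) : ∃ σ ∈ c.support, f ∘ σ = τ := by
  classical
  obtain ⟨σ, hσ, e⟩ := Finset.mem_image.1 (Finsupp.mapDomain_support h)
  exact ⟨σ, hσ, e⟩

theorem chainSupp_vmap_subset {β : Type*} (f : α → β) (c : DChain α m) :
    chainSupp (vmap f c) ⊆ f '' chainSupp c := by
  intro x hx
  obtain ⟨τ, hτ, j, rfl⟩ := mem_chainSupp.1 hx
  obtain ⟨σ, hσ, rfl⟩ := exists_of_mem_support_vmap hτ
  exact ⟨σ j, mem_chainSupp.2 ⟨σ, hσ, j, rfl⟩, rfl⟩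

/-- The cone over a discrete chain with apex `x`. -/
noncomputable def cone (x : α) : DChain α m →ₗ[ℤ] DChain α (m + 1) :=
  Finsupp.lmapDomain ℤ ℤ (fun σ => (Fin.cons x σ : Fin (m + 1) → α))

theorem cone_single (x : α) (σ : Fin m → α) (a : ℤ) :
    cone x (Finsupp.single σ a) = Finsupp.single (Fin.cons x σ : Fin (m + 1) → α) a :=
  Finsupp.mapDomain_single

theorem dbd_cone (x : α) (c : DChain α (m + 1)) : dbd (cone x c) = c - cone x (dbd c) := by
  induction c using Finsupp.induction_linear with
  | zero => simp
  | add a b ha hb => simp only [map_add, ha, hb]; abel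
  | single σ a =>
    rw [cone_single, dbd_single, dbd_single, Fin.sum_univ_succ, map_sum, sub_eq_add_neg,
      ← Finset.sum_neg_distrib]
    congr 1
    · simp only [Fin.val_zero, pow_zero, one_smul, Fin.succAbove_zero]
      rfl
    · refine Finset.sum_congr rfl fun i _ => ?_
      have : (Fin.cons x σ : Fin (m + 2) → α) ∘ i.succ.succAbove =
          Fin.cons x (σ ∘ i.succAbove) := by
        funext j
        refine Fin.cases ?_ (fun j => ?_) j <;> simp
      rw [this, map_smul, cone_single, Fin.val_succ, pow_succ, mul_neg_one, neg_smul]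

theorem dbd_dbd (d : DChain α (m + 2)) : dbd (dbd d) = 0 := by
  induction m with
  | zero =>
    induction d using Finsupp.induction_linear with
    | zero => simp
    | add x y hx hy => rw [map_add, map_add, hx, hy, add_zero]
    | single σ a =>
      rw [dbd_single_edge, map_sub, dbd_single, dbd_single, Fin.sum_univ_one, Fin.sum_univ_one,
        Subsingleton.elim ((fun _ : Fin 1 => σ 1) ∘ _) ((fun _ : Fin 1 => σ 0) ∘ _), sub_self]
  | succ m ih =>
    induction d using Finsupp.induction_linear with
    | zero => simp
    | add x y hx hy => rw [map_add, map_add, hx, hy, add_zero]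
    | single σ a =>
      rw [← Fin.cons_self_tail σ, ← cone_single, dbd_cone, map_sub, dbd_cone, ih, map_zero,
        sub_zero, sub_self]

theorem chainSupp_cone_subset (x : α) (c : DChain α m) :
    chainSupp (cone x c) ⊆ insert x (chainSupp c) := by
  classical
  intro y hy
  obtain ⟨τ, hτ, j, rfl⟩ := mem_chainSupp.1 hy
  obtain ⟨σ, hσ, rfl⟩ := Finset.mem_image.1 (Finsupp.mapDomain_support hτ)
  refine Fin.cases ?_ (fun j => ?_) j
  · simp
  · simp only [Fin.cons_succ]
    exact Or.inr (mem_chainSupp.2 ⟨σ, hσ, j, rfl⟩)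

section Metric

variable {X : Type*} [PseudoMetricSpace X]

theorem dist_le_of_fine {δ : ℝ} {c : DChain X m} (h : FineLE δ c) {σ : Fin m → X}
    (hσ : σ ∈ c.support) (i j : Fin m) : dist (σ i) (σ j) ≤ δ :=
  (Metric.dist_le_diam_of_mem (Set.finite_range σ).isBounded ⟨i, rfl⟩ ⟨j, rfl⟩).trans (h σ hσ)

theorem fineLE_of_dist {δ : ℝ} (hδ : 0 ≤ δ) {c : DChain X m}
    (h : ∀ σ ∈ c.support, ∀ i j, dist (σ i) (σ j) ≤ δ) : FineLE δ c := by
  intro σ hσ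
  refine Metric.diam_le_of_forall_dist_le hδ ?_
  rintro _ ⟨i, rfl⟩ _ ⟨j, rfl⟩
  exact h σ hσ i j

theorem fineLE_add {δ : ℝ} {c d : DChain X m} (hc : FineLE δ c) (hd : FineLE δ d) :
    FineLE δ (c + d) := by
  classical
  intro σ hσ
  rcases Finset.mem_union.1 (Finsupp.support_add hσ) with h | h
  exacts [hc σ h, hd σ h]

theorem fineLE_dbd {δ : ℝ} {d : DChain X (m + 1)} (hd : FineLE δ d) : FineLE δ (dbd d) := by
  intro σ hσ
  obtain ⟨τ, hτ, i, rfl⟩ := exists_of_mem_support_dbd hσ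
  exact (Metric.diam_mono (Set.range_comp_subset_range _ _) (Set.finite_range τ).isBounded).trans
    (hd τ hτ)

/-- A cycle of diameter at most `δ` bounds a `δ`-fine chain with the same vertices. -/
theorem exists_filling_of_diam_le {δ : ℝ} {c : DChain X (m + 1)} (hc : dbd c = 0)
    (h : Metric.diam (chainSupp c) ≤ δ) :
    ∃ d : DChain X (m + 2), dbd d = c ∧ FineLE δ d ∧ chainSupp d ⊆ chainSupp c := by
  rcases (chainSupp c).eq_empty_or_nonempty with he | ⟨x, hx⟩
  · have h0 : c = 0 := by
      rw [← Finsupp.support_eq_empty, Finset.eq_empty_iff_forall_notMem]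
      intro σ hσ
      have : σ 0 ∈ chainSupp c := mem_chainSupp.2 ⟨σ, hσ, 0, rfl⟩
      simp [he] at this
    exact ⟨0, by simp [h0], fun σ hσ => by simp at hσ, fun x hx => by simp [chainSupp] at hx⟩
  · have hs : chainSupp (cone x c) ⊆ chainSupp c :=
      (chainSupp_cone_subset x c).trans (Set.insert_subset hx le_rfl)
    refine ⟨cone x c, by rw [dbd_cone, hc, map_zero, sub_zero], fun σ hσ => ?_, hs⟩
    refine (Metric.diam_mono ?_ (finite_chainSupp c).isBounded).trans h
    rintro _ ⟨j, rfl⟩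
    exact hs (mem_chainSupp.2 ⟨σ, hσ, j, rfl⟩)

end Metric

end DChain

namespace BallSystem

variable {X : Type*} [MetricSpace X]

/-- Every point of `S` has `φ`-value at most `α`, or lies in a ball of `L` blown up by `K`, with a
bound on its `φ`-value that improves with the radius of that ball. -/
def PotentialBound (K : ℝ) (s : X → ℝ) (L : Finset X) (φ : X → ℝ) (α b : ℝ) (S : Set X) : Prop :=
  ∀ x ∈ S, φ x ≤ α ∨ ∃ q ∈ L, dist x q ≤ K * s q ∧ φ x ≤ α + 5 * K * b - 3 * K * s q

/-- The potential bounds which guarantee that `S` stays away from the centres in `L`. -/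
def Avoids (K : ℝ) (s : X → ℝ) (L : Finset X) (S : Set X) : Prop :=
  ∀ p ∈ L, PotentialBound K s L (fun x => -dist x p) (-(s p / (2 * K))) (s p / K ^ 4) S

/-- The last set arises from the one before it by pushing points off the ball of radius `s q`
around `q`. -/
def IsPush (K : ℝ) (s : X → ℝ) (q : X) (S S' : Set X) : Prop :=
  ∀ x ∈ S', s q / (2 * K) ≤ dist x q ∧
    (x ∈ S ∨ (dist x q ≤ K * s q ∧ ∃ y ∈ S, dist y q ≤ s q))

/-- Balls which intersect after being blown up by `K` have very different radii. -/
def Separated (K : ℝ) (s : X → ℝ) (P : Set X) : Prop :=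
  ∀ p ∈ P, ∀ q ∈ P, p ≠ q → s p ≤ s q → ∀ x, dist x p ≤ K * s p → dist x q ≤ K * s q →
    s p ≤ s q / K ^ 4

variable {K : ℝ} {s : X → ℝ} {P : Set X} {L : Finset X} {φ : X → ℝ} {α b : ℝ} {S S' : Set X}

theorem PotentialBound.of_le (h : ∀ x ∈ S, φ x ≤ α) : PotentialBound K s L φ α b S :=
  fun x hx => Or.inl (h x hx)

theorem PotentialBound.mono (h : PotentialBound K s L φ α b S') (hS : S ⊆ S') :
    PotentialBound K s L φ α b S :=
  fun x hx => h x (hS hx)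

theorem PotentialBound.le (hK : 0 ≤ K) (hs : ∀ p ∈ L, 0 ≤ s p) (hb : 0 ≤ b)
    (h : PotentialBound K s L φ α b S) {x : X} (hx : x ∈ S) : φ x ≤ α + 5 * K * b := by
  rcases h x hx with h | ⟨q, hq, -, h⟩
  · have : 0 ≤ 5 * K * b := by positivity
    linarith
  · have : 0 ≤ 3 * K * s q := by have := hs q hq; positivity
    linarith

theorem PotentialBound.push [DecidableEq X] (hK : 9 ≤ K) (hsep : Separated K s P)
    (hL : ↑L ⊆ P) {q : X} (hq : q ∈ P) (hqL : q ∉ L) (hmin : ∀ p ∈ L, s q ≤ s p)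
    (hs : ∀ p ∈ P, 0 < s p) (hφ : ∀ x y, φ x ≤ φ y + dist x y)
    (hb : s q ≤ b ∨ ∀ x, dist x q ≤ K * s q → φ x ≤ α)
    (h : PotentialBound K s L φ α b S) (hp : IsPush K s q S S') :
    PotentialBound K s (insert q L) φ α b S' := by
  intro x hx
  have hsq := hs q hq
  rcases (hp x hx).2 with hxS | ⟨hxq, y, hy, hyq⟩
  · rcases h x hxS with h1 | ⟨q', hq', h1⟩
    · exact Or.inl h1
    · exact Or.inr ⟨q', Finset.mem_insert_of_mem hq', h1⟩
  rcases hb with hb | hb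
  swap
  · exact Or.inl (hb x hxq)
  refine Or.inr ⟨q, Finset.mem_insert_self _ _, hxq, ?_⟩
  have hxy : dist x y ≤ 2 * (K * s q) := by
    have := dist_triangle_right x y q
    nlinarith
  have h1 := hφ x y
  rcases h y hy with h2 | ⟨q', hq', hyq', h2⟩
  · nlinarith [mul_le_mul_of_nonneg_left hb (by linarith : 0 ≤ K)]
  · have hne : q ≠ q' := fun e => hqL (e ▸ hq')
    have h3 := hsep q hq q' (hL hq') hne (hmin q' hq') y (by nlinarith) hyq'
    have hs' := hs q' (hL hq')
    have h4 : s q' / K ^ 4 ≤ s q' / 2 := by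
      have : (9 : ℝ) ^ 4 ≤ K ^ 4 := by gcongr
      gcongr
      linarith
    have h5 : K * (2 * s q) ≤ K * s q' := by gcongr; linarith
    nlinarith

theorem Avoids.push [DecidableEq X] (hK : 9 ≤ K) (hsep : Separated K s P)
    (hL : ↑L ⊆ P) {q : X} (hq : q ∈ P) (hqL : q ∉ L) (hmin : ∀ p ∈ L, s q ≤ s p)
    (hs : ∀ p ∈ P, 0 < s p) (h : Avoids K s L S) (hp : IsPush K s q S S') :
    Avoids K s (insert q L) S' := by
  intro p hpL
  rcases Finset.mem_insert.1 hpL with rfl | hpL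
  · exact PotentialBound.of_le fun x hx => neg_le_neg (hp x hx).1
  refine (h p hpL).push hK hsep hL hq hqL hmin hs (fun x y => ?_) ?_ hp
  · have := dist_triangle_left y p x
    linarith
  by_cases hle : s q ≤ s p / K ^ 4
  · exact Or.inl hle
  · refine Or.inr fun x hx => ?_
    have hne : q ≠ p := fun e => hqL (e ▸ hpL)
    have hx' : ¬ dist x p ≤ K * s p := fun h' =>
      hle (hsep q hq p (hL hpL) hne (hmin p hpL) x hx h')
    have hsp := hs p (hL hpL)
    have : s p / (2 * K) ≤ K * s p := by
      rw [div_le_iff₀ (by linarith)]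
      nlinarith [mul_pos hsp (by linarith : 0 < K)]
    linarith

theorem Avoids.le_dist (hK : 9 ≤ K) (hs : ∀ p ∈ L, 0 < s p) (h : Avoids K s L S)
    {p x : X} (hp : p ∈ L) (hx : x ∈ S) : s p / (4 * K) ≤ dist x p := by
  have hsp := hs p hp
  have hK0 : 0 < K := by linarith
  have h1 := (h p hp).le hK0.le (fun q hq => (hs q hq).le) (by positivity) hx
  have h2 : 5 * K * (s p / K ^ 4) ≤ s p / (4 * K) := by
    rw [le_div_iff₀ (by positivity)]
    have : 5 * K * (s p / K ^ 4) * (4 * K) = s p * (20 / K ^ 2) := by field_simp; ring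
    rw [this]
    have : 20 / K ^ 2 ≤ 1 := by rw [div_le_one (by positivity)]; nlinarith
    nlinarith
  have h3 : s p / (2 * K) = s p / (4 * K) + s p / (4 * K) := by field_simp; norm_num
  linarith

theorem Avoids.mono (h : Avoids K s L S') (hS : S ⊆ S') : Avoids K s L S :=
  fun p hp => (h p hp).mono hS

/-- If points of `S` can be pushed off single balls, they can be pushed off finitely many smaller
balls one after the other. -/
theorem exists_avoiding_point [DecidableEq X] (hK : 9 ≤ K) (hsep : Separated K s P)
    (hs : ∀ p ∈ P, 0 < s p) (hpush : ∀ q ∈ P, ∀ x : X, ∃ y, IsPush K s q {x} {y})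
    (hL : ↑L ⊆ P) {x : X} (hx : Avoids K s L {x}) {b : ℝ} (F : Finset X) (hF : ↑F ⊆ P)
    (hFb : ∀ q ∈ F, s q ≤ b) (hFL : ∀ q ∈ F, ∀ p ∈ L, s q ≤ s p) (hdisj : Disjoint F L) :
    ∃ y, Avoids K s (F ∪ L) {y} ∧
      PotentialBound K s (F ∪ L) (fun z => dist z x) 0 b {y} := by
  induction F using Finset.induction_on_min_value s with
  | empty => exact ⟨x, by simpa using hx, PotentialBound.of_le (by simp)⟩
  | insert q F hqF hmin ih =>
    rw [Finset.disjoint_insert_left] at hdisj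
    simp only [Finset.coe_insert, Set.insert_subset_iff] at hF
    simp only [Finset.mem_insert, forall_eq_or_imp] at hFb hFL
    obtain ⟨y, hy1, hy2⟩ := ih hF.2 hFb.2 hFL.2 hdisj.2
    obtain ⟨z, hz⟩ := hpush q hF.1 y
    have hU : ↑(F ∪ L) ⊆ P := by simpa using ⟨hF.2, hL⟩
    have hqU : q ∉ F ∪ L := by simp [hqF, hdisj.1]
    have hmU : ∀ p ∈ F ∪ L, s q ≤ s p := fun p hp =>
      (Finset.mem_union.1 hp).elim (hmin p) (hFL.1 p)
    refine ⟨z, ?_, ?_⟩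
    · rw [Finset.insert_union]
      exact hy1.push hK hsep hU hF.1 hqU hmU hs hz
    · rw [Finset.insert_union]
      refine hy2.push hK hsep hU hF.1 hqU hmU hs (fun u v => ?_) (Or.inl hFb.1) hz
      have := dist_triangle u v x
      linarith

/-- A point which avoids the large balls is close to a point which avoids all balls. -/
theorem exists_close_avoiding_all [CompactSpace X] (hK : 9 ≤ K) (hsep : Separated K s P)
    (hs : ∀ p ∈ P, 0 < s p) (hpush : ∀ q ∈ P, ∀ x : X, ∃ y, IsPush K s q {x} {y})
    (hL : ↑L ⊆ P) {x : X} (hx : Avoids K s L {x}) {b : ℝ} (hb : 0 ≤ b)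
    (hb1 : ∀ q ∈ P, q ∉ L → s q ≤ b) (hb2 : ∀ q ∈ P, q ∉ L → ∀ p ∈ L, s q ≤ s p) :
    ∃ y, dist y x ≤ 5 * K * b ∧ ∀ p ∈ P, s p / (4 * K) ≤ dist p y := by
  classical
  have hne : (Metric.closedBall x (5 * K * b) ∩
      ⋂ p : P, {y : X | s p / (4 * K) ≤ dist (p : X) y}).Nonempty := by
    refine (isCompact_univ.of_isClosed_subset Metric.isClosed_closedBall
      (Set.subset_univ _)).inter_iInter_nonempty _ (fun p => ?_) fun u => ?_
    · exact isClosed_le continuous_const (continuous_const.dist continuous_id)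
    · have hFP : ↑(u.image Subtype.val \ L) ⊆ P := by
        intro q hq
        simp only [Finset.coe_sdiff, Finset.coe_image, Set.mem_sdiff, Set.mem_image] at hq
        obtain ⟨⟨a, -, rfl⟩, -⟩ := hq
        exact a.2
      obtain ⟨y, hy1, hy2⟩ := exists_avoiding_point hK hsep hs hpush hL hx
        (u.image Subtype.val \ L) hFP
        (fun q hq => hb1 q (hFP hq) (Finset.mem_sdiff.1 hq).2)
        (fun q hq => hb2 q (hFP hq) (Finset.mem_sdiff.1 hq).2) Finset.sdiff_disjoint
      have hUP : ∀ p ∈ u.image Subtype.val \ L ∪ L, 0 < s p := fun p hp =>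
        hs p ((Finset.mem_union.1 hp).elim (fun h => hFP h) fun h => hL h)
      refine ⟨y, ?_, ?_⟩
      · have := hy2.le (by linarith) (fun p hp => (hUP p hp).le) hb rfl
        simpa using this
      · simp only [Set.mem_iInter]
        intro p hp
        rw [Set.mem_ofPred_eq, dist_comm]
        refine hy1.le_dist hK hUP ?_ rfl
        simp only [Finset.mem_union, Finset.mem_sdiff, Finset.mem_image]
        by_cases h : (p : X) ∈ L
        · exact Or.inr h
        · exact Or.inl ⟨⟨p, hp, rfl⟩, h⟩
  obtain ⟨y, hy1, hy2⟩ := hne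
  refine ⟨y, hy1, fun p hp => ?_⟩
  exact Set.mem_iInter.1 hy2 ⟨p, hp⟩

/-- Filling of `0`-cycles lets one move a point off a ball. -/
theorem exists_push_point {k : ℕ} {g : ℝ → ℝ} (hK : 9 ≤ K)
    (hg : ∀ δ : ℝ, 0 < δ → 0 < g δ ∧ g δ ≤ δ) (hF0 : FillAll (𝒮 := X) k K g) {q : X}
    (hs : 0 < s q) {z : X} (hz : s q ≤ dist z q) (x : X) :
    ∃ y, IsPush K s q {x} {y} := by
  classical
  have hsK : s q / (2 * K) ≤ s q := div_le_self hs.le (by linarith)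
  by_cases hxq : s q ≤ dist x q
  · refine ⟨x, ?_⟩
    rintro _ rfl
    exact ⟨hsK.trans hxq, Or.inl rfl⟩
  by_contra! hcon
  have hno : ∀ y, s q ≤ dist y q → ¬ dist y q ≤ K * s q := by
    intro y h1 h2
    refine hcon y ?_
    rintro _ rfl
    exact ⟨hsK.trans h1, Or.inr ⟨h2, x, rfl, (not_le.1 hxq).le⟩⟩
  set χ : X → ℤ := fun y => if s q ≤ dist y q then 1 else 0 with hχ
  let Λ : DChain X 1 →ₗ[ℤ] ℤ := Finsupp.linearCombination ℤ fun σ => χ (σ 0)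
  have hΛ : ∀ σ a, Λ (Finsupp.single σ a) = a * χ (σ 0) := fun σ a => by
    simp [Λ, Finsupp.linearCombination_single]
  obtain ⟨d, hd, hfine⟩ : ∃ d : DChain X 2, dbd d =
      (Finsupp.single (fun _ => z) 1 - Finsupp.single (fun _ => x) 1 : DChain X 1) ∧
      FineLE (s q) d := by
    obtain ⟨d, hd, hfine, -⟩ := hF0 (s q) hs 0 (Nat.zero_le _)
      (Finsupp.single (fun _ => z) 1 - Finsupp.single (fun _ => x) 1)
      (by
        rw [map_sub, DChain.dbd_single, DChain.dbd_single, sub_eq_zero]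
        simp only [Fin.sum_univ_succ, Finset.univ_eq_empty, Finset.sum_empty]
        congr 3
        funext j
        exact j.elim0)
      (by
        refine DChain.fineLE_of_dist (hg _ hs).1.le fun σ _ i j => ?_
        rw [Fin.fin_one_eq_zero i, Fin.fin_one_eq_zero j, dist_self]
        exact (hg _ hs).1.le)
    exact ⟨d, hd, hfine⟩
  have h1 : Λ (dbd d) = 1 := by
    rw [hd, map_sub, hΛ, hΛ]
    simp [hχ, hz, hxq]
  have h0 : Λ (dbd d) = 0 := by
    conv_lhs => rw [← Finsupp.sum_single d]
    rw [Finsupp.sum, map_sum, map_sum]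
    refine Finset.sum_eq_zero fun σ hσ => ?_
    have e : χ (σ 0) = χ (σ 1) := by
      have h01 := DChain.dist_le_of_fine hfine hσ 0 1
      have t1 := dist_triangle_left (σ 1) q (σ 0)
      have t2 := dist_triangle (σ 0) (σ 1) q
      have n0 := hno (σ 0)
      have n1 := hno (σ 1)
      simp only [hχ]
      split_ifs with c0 c1 c1
      · rfl
      · exact absurd (by nlinarith) (n0 c0)
      · exact absurd (by nlinarith) (n1 c1)
      · rfl
    rw [DChain.dbd_single_edge, map_sub, hΛ, hΛ, e, sub_self]
  omega

/-- A fine filling can be pushed off a single ball, away from its boundary. -/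
theorem exists_push_chain {k : ℕ} {g : ℝ → ℝ} {r : X → ℝ} (hK : 9 ≤ K)
    (hg : ∀ δ : ℝ, 0 < δ → 0 < g δ ∧ g δ ≤ δ) (hF1 : FillAnnuli k K g P r) {i : ℕ} (hi : i < k)
    {q : X} (hq : q ∈ P) {δ : ℝ} (hδ : 0 < δ) (hδs : δ ≤ s q / 2) (hsr : s q ≤ r q / K)
    {d : DChain X (i + 2)} (hd : FineLE (g δ) d)
    (hout : ∀ x ∈ chainSupp (dbd d), s q ≤ dist q x) :
    ∃ d' : DChain X (i + 2), dbd d' = dbd d ∧ FineLE δ d' ∧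
      IsPush K s q (chainSupp d) (chainSupp d') ∧
      Metric.diam (chainSupp d') ≤
        Metric.diam (chainSupp d) + K * √(Metric.diam (chainSupp d)) := by
  classical
  have hs : 0 < s q := by linarith
  have hsK : s q / (2 * K) ≤ s q / 2 := by gcongr; linarith
  let near : (Fin (i + 2) → X) → Prop := fun σ => ∃ j, dist q (σ j) < s q / 2
  set a : DChain X (i + 2) := d.filter near with ha
  set o : DChain X (i + 2) := d.filter (fun σ => ¬ near σ) with ho
  have hsum : a + o = d := Finsupp.filter_add_filter_not d near
  have had : a.support ⊆ d.support := by
    rw [ha, Finsupp.support_filter]; exact Finset.filter_subset _ _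
  have hod : o.support ⊆ d.support := by
    rw [ho, Finsupp.support_filter]; exact Finset.filter_subset _ _
  have hcs : ∀ {u : DChain X (i + 2)}, u.support ⊆ d.support → chainSupp u ⊆ chainSupp d :=
    fun h => Set.biUnion_subset_biUnion_left h
  have hfa : FineLE (g δ) a := fun σ hσ => hd σ (had hσ)
  have hfo : FineLE δ o := fun σ hσ => (hd σ (hod hσ)).trans (hg δ hδ).2
  have ho_far : ∀ x ∈ chainSupp o, s q / 2 ≤ dist q x := by
    intro x hx
    obtain ⟨σ, hσ, j, rfl⟩ := DChain.mem_chainSupp.1 hx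
    rw [ho, Finsupp.support_filter] at hσ
    by_contra hlt
    exact (Finset.mem_filter.1 hσ).2 ⟨j, not_le.1 hlt⟩
  have ha_near : ∀ x ∈ chainSupp a, dist q x < s q := by
    intro x hx
    obtain ⟨σ, hσ, j, rfl⟩ := DChain.mem_chainSupp.1 hx
    have h1 := DChain.dist_le_of_fine hfa hσ
    rw [ha, Finsupp.support_filter] at hσ
    obtain ⟨l, hl⟩ := (Finset.mem_filter.1 hσ).2
    have h2 := dist_triangle q (σ l) (σ j)
    have h3 := h1 l j
    have h4 := (hg δ hδ).2
    linarith
  have hann : chainSupp (dbd a) ⊆ annulus q (s q / 2) (s q) := by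
    intro x hx
    have hlt := ha_near x (DChain.chainSupp_dbd_subset a hx)
    refine ⟨?_, hlt.le⟩
    have e : dbd a = dbd d + dbd (-o) := by rw [← map_add, ← hsum]; congr 1; abel
    rw [e] at hx
    rcases DChain.chainSupp_add_subset _ _ hx with h | h
    · exact absurd (hout x h) (not_le.2 hlt)
    · refine ho_far x ?_
      have := DChain.chainSupp_dbd_subset _ h
      simpa only [chainSupp, Finsupp.support_neg] using this
  have hpush_o : ∀ x ∈ chainSupp o, s q / (2 * K) ≤ dist x q ∧
      (x ∈ chainSupp d ∨ (dist x q ≤ K * s q ∧ ∃ y ∈ chainSupp d, dist y q ≤ s q)) :=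
    fun x hx => ⟨hsK.trans (by rw [dist_comm]; exact ho_far x hx), Or.inl (hcs hod hx)⟩
  rcases (chainSupp (dbd a)).eq_empty_or_nonempty with hempty | ⟨w, hw⟩
  · have h0 : dbd a = 0 := by
      rw [← Finsupp.support_eq_empty, Finset.eq_empty_iff_forall_notMem]
      intro σ hσ
      have : σ 0 ∈ chainSupp (dbd a) := DChain.mem_chainSupp.2 ⟨σ, hσ, 0, rfl⟩
      simp [hempty] at this
    refine ⟨o, by rw [← hsum, map_add, h0, zero_add], hfo, hpush_o, ?_⟩
    refine (Metric.diam_mono (hcs hod) (DChain.finite_chainSupp d).isBounded).trans ?_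
    have : 0 ≤ K * √(Metric.diam (chainSupp d)) := by positivity
    linarith
  have hwd : w ∈ chainSupp d := hcs had (DChain.chainSupp_dbd_subset a hw)
  have hcyc : dbd (dbd a) = 0 := DChain.dbd_dbd a
  obtain ⟨e, he, hfe, hse, hde⟩ := hF1 q hq δ hδ i hi (s q / 2) (s q) hδs (by linarith) hsr
    (dbd a) hcyc (DChain.fineLE_dbd hfa) hann
  have hsub : chainSupp (o + e) ⊆ chainSupp d ∪ chainSupp e :=
    (DChain.chainSupp_add_subset o e).trans (Set.union_subset_union_left _ (hcs hod))
  refine ⟨o + e, by rw [map_add, he, ← map_add, add_comm o, hsum], DChain.fineLE_add hfo hfe,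
    fun x hx => ?_, ?_⟩
  · rcases DChain.chainSupp_add_subset o e hx with h | h
    · exact hpush_o x h
    · have h1 := hse h
      refine ⟨?_, Or.inr ⟨?_, w, hwd, ?_⟩⟩
      · rw [dist_comm, ← div_div]; exact h1.1
      · rw [dist_comm]; exact h1.2
      · rw [dist_comm]; exact (hann hw).2
  · have hwe : w ∈ chainSupp e := DChain.chainSupp_dbd_subset e (he ▸ hw)
    have hbd : Bornology.IsBounded (chainSupp d) := (DChain.finite_chainSupp d).isBounded
    calc Metric.diam (chainSupp (o + e)) ≤ Metric.diam (chainSupp d ∪ chainSupp e) :=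
          Metric.diam_mono hsub (hbd.union (DChain.finite_chainSupp e).isBounded)
      _ ≤ Metric.diam (chainSupp d) + Metric.diam (chainSupp e) :=
          Metric.diam_union' ⟨w, hwd, hwe⟩
      _ ≤ _ := by
          gcongr
          refine hde.trans ?_
          gcongr
          exact Metric.diam_mono ((DChain.chainSupp_dbd_subset a).trans (hcs had)) hbd

/-- The control function for the diameter of a chain when pushing it off a single ball. -/
noncomputable def growth (K t : ℝ) : ℝ := t + K * √t

theorem monotone_growth (hK : 0 ≤ K) : Monotone (growth K) := fun a b h => by
  unfold growth
  gcongr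

theorem le_growth (hK : 0 ≤ K) (t : ℝ) : t ≤ growth K t := by
  have : 0 ≤ K * √t := by positivity
  unfold growth
  linarith

theorem growth_iterate_le (hK : 0 ≤ K) {a b : ℕ} (h : a ≤ b) {t u : ℝ} (htu : t ≤ u) :
    (growth K)^[a] t ≤ (growth K)^[b] u :=
  ((monotone_growth hK).iterate a htu).trans
    ((monotone_growth hK).monotone_iterate_of_le_map (le_growth hK u) h)

theorem tendsto_growth_iterate (K : ℝ) (n : ℕ) :
    Filter.Tendsto (growth K)^[n] (nhds 0) (nhds 0) := by
  have hc : Continuous (growth K) := by unfold growth; fun_prop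
  have h0 : (growth K)^[n] 0 = 0 := Function.iterate_fixed (by simp [growth]) n
  simpa only [h0] using (hc.iterate n).tendsto 0

/-- A fine filling can be pushed off finitely many balls, one after the other. -/
theorem exists_avoiding_chain {k : ℕ} {g : ℝ → ℝ} {r : X → ℝ} (hK : 9 ≤ K)
    (hg : ∀ δ : ℝ, 0 < δ → 0 < g δ ∧ g δ ≤ δ) (hF1 : FillAnnuli k K g P r)
    (hsep : Separated K s P) (hs : ∀ p ∈ P, 0 < s p) (hsr : ∀ p ∈ P, s p ≤ r p / K)
    {i : ℕ} (hi : i < k) {d₀ : DChain X (i + 2)} (hne : (chainSupp (dbd d₀)).Nonempty)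
    (F : Finset X) (hF : ↑F ⊆ P) {δ : ℝ} (hδ : 0 < δ) (hδF : ∀ q ∈ F, δ ≤ s q / 2)
    (hd₀ : FineLE (g^[F.card] δ) d₀)
    (hout : ∀ q ∈ F, ∀ x ∈ chainSupp (dbd d₀), s q ≤ dist q x) :
    ∃ d : DChain X (i + 2), dbd d = dbd d₀ ∧ FineLE δ d ∧ Avoids K s F (chainSupp d) ∧
      Metric.diam (chainSupp d) ≤ (growth K)^[F.card] (Metric.diam (chainSupp d₀)) ∧
      ∀ ε : ℝ, 0 < ε → ∃ Z : Set X, Z.Finite ∧ Z.Nonempty ∧ ∃ F' ⊆ F, (∀ q ∈ F', ε ≤ s q) ∧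
        Metric.diam Z ≤ (growth K)^[F'.card] (Metric.diam (chainSupp d₀)) ∧
        PotentialBound K s F (fun x => Metric.infDist x Z) 0 ε (chainSupp d) := by
  classical
  induction F using Finset.induction_on_min_value s generalizing δ with
  | empty =>
    refine ⟨d₀, rfl, hd₀, by simp [Avoids], le_rfl, fun ε _ => ⟨chainSupp d₀,
      DChain.finite_chainSupp _, hne.mono (DChain.chainSupp_dbd_subset d₀), ∅, le_rfl, by simp,
      le_rfl, PotentialBound.of_le fun x hx => (Metric.infDist_zero_of_mem hx).le⟩⟩
  | insert q F hqF hmin ih =>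
    simp only [Finset.coe_insert, Set.insert_subset_iff] at hF
    simp only [Finset.mem_insert, forall_eq_or_imp] at hδF hout
    rw [Finset.card_insert_of_notMem hqF, Function.iterate_succ_apply] at hd₀
    obtain ⟨d, hd, hfd, hav, hdiam, hZ⟩ := ih hF.2 (hg δ hδ).1
      (fun p hp => (hg δ hδ).2.trans (hδF.2 p hp)) hd₀ hout.2
    obtain ⟨d', hd', hfd', hpush, hdiam'⟩ := exists_push_chain hK hg hF1 hi hF.1 hδ hδF.1
      (hsr q hF.1) hfd (by rw [hd]; exact hout.1)
    have hdiam'' : Metric.diam (chainSupp d') ≤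
        (growth K)^[(insert q F).card] (Metric.diam (chainSupp d₀)) := by
      rw [Finset.card_insert_of_notMem hqF, Function.iterate_succ_apply']
      exact hdiam'.trans (monotone_growth (by linarith) hdiam)
    refine ⟨d', hd'.trans hd, hfd', hav.push hK hsep hF.2 hF.1 hqF hmin hs hpush, hdiam'',
      fun ε hε => ?_⟩
    by_cases hqε : ε ≤ s q
    · refine ⟨chainSupp d', DChain.finite_chainSupp _, ?_, insert q F, le_rfl, ?_, hdiam'', ?_⟩
      · rw [← hd, ← hd'] at hne
        exact hne.mono (DChain.chainSupp_dbd_subset d')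
      · simp only [Finset.mem_insert, forall_eq_or_imp]
        exact ⟨hqε, fun p hp => hqε.trans (hmin p hp)⟩
      · exact PotentialBound.of_le fun x hx => (Metric.infDist_zero_of_mem hx).le
    · obtain ⟨Z, hZf, hZn, F', hF', hF'ε, hZd, hZp⟩ := hZ ε hε
      exact ⟨Z, hZf, hZn, F', hF'.trans (Finset.subset_insert _ _), hF'ε, hZd,
        hZp.push hK hsep hF.2 hF.1 hqF hmin hs
          (fun x y => Metric.infDist_le_infDist_add_dist) (Or.inl (not_le.1 hqε).le) hpush⟩

theorem iterate_pos_le {g : ℝ → ℝ} (hg : ∀ δ : ℝ, 0 < δ → 0 < g δ ∧ g δ ≤ δ) (j : ℕ) {t : ℝ}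
    (ht : 0 < t) : 0 < g^[j] t ∧ g^[j] t ≤ t := by
  induction j with
  | zero => exact ⟨ht, le_rfl⟩
  | succ j ih =>
    rw [Function.iterate_succ_apply']
    exact ⟨(hg _ ih.1).1, (hg _ ih.1).2.trans ih.2⟩

theorem diam_le_of_infDist_le {S Z : Set X} {b : ℝ} (hb : 0 ≤ b) (hZ : Z.Finite)
    (hZn : Z.Nonempty) (h : ∀ x ∈ S, Metric.infDist x Z ≤ b) :
    Metric.diam S ≤ Metric.diam Z + 2 * b := by
  have hz : ∀ x ∈ S, ∃ z ∈ Z, dist x z ≤ b := fun x hx => by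
    obtain ⟨z, hz, e⟩ := hZ.isCompact.exists_infDist_eq_dist hZn x
    exact ⟨z, hz, e ▸ h x hx⟩
  refine Metric.diam_le_of_forall_dist_le (by positivity) fun x hx y hy => ?_
  obtain ⟨u, hu, hxu⟩ := hz x hx
  obtain ⟨v, hv, hyv⟩ := hz y hy
  have h1 := Metric.dist_le_diam_of_mem hZ.isBounded hu hv
  have h2 := dist_triangle4 x u v y
  rw [dist_comm v y] at h2
  linarith

/-- The bound for the diameter of a filling in terms of the diameter `t` of its boundary, when
`N ε` bounds the number of balls of radius at least `ε`. -/
noncomputable def diamBound (K : ℝ) (N : ℝ → ℕ) (t : ℝ) : ℝ :=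
  ⨅ ε : Set.Ioi (0 : ℝ), ((growth K)^[N ε] (K * √t) + 10 * K * ε + 10 * K * t)

theorem le_diamBound {N : ℝ → ℕ} {t u : ℝ}
    (h : ∀ ε : ℝ, 0 < ε → u ≤ (growth K)^[N ε] (K * √t) + 10 * K * ε + 10 * K * t) :
    u ≤ diamBound K N t := by
  have : Nonempty (Set.Ioi (0 : ℝ)) := ⟨⟨1, Set.mem_Ioi.2 one_pos⟩⟩
  exact le_ciInf fun ε => h ε ε.2

theorem growth_iterate_nonneg (hK : 0 ≤ K) (n : ℕ) {t : ℝ} (ht : 0 ≤ t) :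
    0 ≤ (growth K)^[n] t :=
  ht.trans (growth_iterate_le hK (Nat.zero_le n) le_rfl)

theorem tendsto_diamBound (hK : 0 < K) (N : ℝ → ℕ) :
    Filter.Tendsto (diamBound K N) (nhdsWithin 0 (Set.Ioi 0)) (nhds 0) := by
  have hterm : ∀ t : ℝ, 0 ≤ t → ∀ ε : ℝ, 0 < ε →
      0 ≤ (growth K)^[N ε] (K * √t) + 10 * K * ε + 10 * K * t := fun t ht ε hε => by
    have := growth_iterate_nonneg hK.le (N ε) (t := K * √t) (by positivity)
    positivity
  rw [Metric.tendsto_nhds]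
  intro ε hε
  set η : ℝ := ε / (20 * K) with hη
  have hη0 : 0 < η := by positivity
  have hlim : Filter.Tendsto
      (fun t : ℝ => (growth K)^[N η] (K * √t) + 10 * K * η + 10 * K * t)
      (nhdsWithin 0 (Set.Ioi 0)) (nhds (0 + 10 * K * η + 10 * K * 0)) := by
    refine Filter.Tendsto.mono_left ?_ nhdsWithin_le_nhds
    have h1 : Filter.Tendsto (fun t : ℝ => K * √t) (nhds 0) (nhds 0) := by
      have : Continuous fun t : ℝ => K * √t := by fun_prop
      simpa using this.tendsto 0
    exact (((tendsto_growth_iterate K (N η)).comp h1).add_const _).add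
      (Filter.tendsto_id.const_mul _)
  have hlt : 0 + 10 * K * η + 10 * K * 0 < ε := by
    have : 10 * K * η = ε / 2 := by rw [hη]; field_simp; norm_num
    linarith
  filter_upwards [hlim.eventually_lt_const hlt, self_mem_nhdsWithin] with t ht ht0
  have ht0' : 0 ≤ t := le_of_lt ht0
  rw [Real.dist_eq, sub_zero, abs_of_nonneg]
  · refine lt_of_le_of_lt (ciInf_le ⟨0, ?_⟩ (⟨η, hη0⟩ : Set.Ioi (0 : ℝ))) ht
    rintro _ ⟨e, rfl⟩
    exact hterm t ht0' e e.2
  · exact le_diamBound fun e he => hterm t ht0' e he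

end BallSystem

/-- filling in the strata, with diameter bounds.  In the ball-system
setup with the filling hypotheses (F0), (F1), (F2) and property (*), with `(𝒮,ρ)` compact
and only finitely many `p ∈ P` with `r_p ≥ r` for each `r > 0`, set
`X_n := 𝒮 − ⋃_{p∈P} B(p, r_p/(nM))` (open balls).  Then there are functions `f₁(n) ≥ n`,
`0 < g₁(δ,n) ≤ δ` and `𝔥(r) → 0` as `r → 0` such that for all `δ > 0`, `n ≥ 1` and
`0 ≤ i < k`, every `g₁(δ,n)`-fine reduced discrete `i`-cycle `c` supported in `X_n` bounds a
`δ`-fine chain `d` supported in `X_{f₁(n)}` with `diam(d) ≤ 𝔥(diam c)`. -/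
theorem stratum_filling {𝒮 : Type*} [MetricSpace 𝒮] [CompactSpace 𝒮]
    (k : ℕ) (hk : 1 ≤ k) (K : ℝ) (hK : 9 ≤ K)
    (g : ℝ → ℝ) (hg : ∀ δ : ℝ, 0 < δ → 0 < g δ ∧ g δ ≤ δ)
    (P : Set 𝒮) (r : 𝒮 → ℝ) (hr : ∀ p ∈ P, 0 < r p)
    (M : ℝ) (hM : 2 * K ^ 2 ≤ M)
    (hF0 : FillAll (𝒮 := 𝒮) k K g) (hF1 : FillAnnuli k K g P r) (hF2 : FillBalls k K g P r)
    (hstar : ∀ p ∈ P, ∀ q ∈ P, p ≠ q → r p ≤ r q →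
      ((Metric.closedBall p (r p / M)) ∩ (Metric.closedBall q (r q / M))).Nonempty →
      r p / M ≤ (r q / M) / K ^ 4)
    (hfin : ∀ ρ : ℝ, 0 < ρ → {p ∈ P | ρ ≤ r p}.Finite) :
    ∃ (f₁ : ℕ → ℕ) (g₁ : ℝ → ℕ → ℝ) (𝔥 : ℝ → ℝ),
      (∀ n, n ≤ f₁ n) ∧
      (∀ δ : ℝ, 0 < δ → ∀ n : ℕ, 0 < g₁ δ n ∧ g₁ δ n ≤ δ) ∧
      Filter.Tendsto 𝔥 (nhdsWithin 0 (Set.Ioi 0)) (nhds 0) ∧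
      ∀ (δ : ℝ), 0 < δ → ∀ (n : ℕ), 1 ≤ n → ∀ (i : ℕ), i < k →
        ∀ c : DChain 𝒮 (i + 1), FineLE (g₁ δ n) c → dbd c = 0 →
          chainSupp c ⊆ {x : 𝒮 | ∀ p ∈ P, r p / (n * M) ≤ dist p x} →
          ∃ d : DChain 𝒮 (i + 2), dbd d = c ∧ FineLE δ d ∧
            chainSupp d ⊆ {x : 𝒮 | ∀ p ∈ P, r p / ((f₁ n) * M) ≤ dist p x} ∧
            Metric.diam (chainSupp d) ≤ 𝔥 (Metric.diam (chainSupp c)) := by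
  classical
  have hK0 : 0 < K := by linarith
  have hM1 : 1 ≤ M := by nlinarith
  have hM0 : 0 < M := by linarith
  have hfM : ∀ n : ℕ, 4 * K * (n + K) ≤ (⌈4 * K * (n + K)⌉₊ : ℝ) := fun n => Nat.le_ceil _
  have hfn : ∀ n : ℕ, (n : ℝ) ≤ (⌈4 * K * (n + K)⌉₊ : ℝ) := fun n => by
    have hn : (0 : ℝ) ≤ n := Nat.cast_nonneg n
    have := hfM n
    nlinarith
  refine ⟨fun n => ⌈4 * K * (n + K)⌉₊,
    fun δ n => g^[{p ∈ P | δ / (20 * K) ≤ r p}.ncard + 1] (δ / (20 * K) / (2 * ((n + K) * M))),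
    BallSystem.diamBound K fun ε => {p ∈ P | ε ≤ r p}.ncard,
    fun n => (Nat.cast_le (α := ℝ)).1 (hfn n), fun δ hδ n => ?_, BallSystem.tendsto_diamBound hK0 _,
    fun δ hδ n hn i hi c hfine hc hsupp => ?_⟩
  · have hn : (0 : ℝ) ≤ n := Nat.cast_nonneg n
    have h1 : 0 < δ / (20 * K) / (2 * ((n + K) * M)) := by positivity
    refine ⟨(BallSystem.iterate_pos_le hg _ h1).1,
      (BallSystem.iterate_pos_le hg _ h1).2.trans ?_⟩
    refine (div_le_self (by positivity) ?_).trans (div_le_self hδ.le (by linarith))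
    nlinarith [mul_le_mul (by linarith : (1 : ℝ) ≤ n + K) hM1 zero_le_one (by linarith)]
  have hn1 : (1 : ℝ) ≤ n := by exact_mod_cast hn
  set θ : ℝ := δ / (20 * K) with hθ
  have hθ0 : 0 < θ := by positivity
  have hθδ : 20 * (K * θ) = δ := by rw [hθ]; field_simp
  have hθK : 9 * θ ≤ K * θ := by gcongr
  have hmem : ∀ p ∈ P, ∀ x : 𝒮, r p / (n * M) ≤ dist p x →
      r p / ((⌈4 * K * (n + K)⌉₊ : ℝ) * M) ≤ dist p x := fun p hp x hx => by
    refine le_trans ?_ hx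
    have := (hr p hp).le
    gcongr
    exact (Nat.cast_le (α := ℝ)).1 (hfn n)
  have hbound : ∀ d : DChain 𝒮 (i + 2),
      (∀ ε : ℝ, 0 < ε → Metric.diam (chainSupp d) ≤
        (BallSystem.growth K)^[{p ∈ P | ε ≤ r p}.ncard] (K * √(Metric.diam (chainSupp c)))
          + 10 * K * ε + 10 * K * Metric.diam (chainSupp c)) →
      Metric.diam (chainSupp d) ≤
        BallSystem.diamBound K (fun ε => {p ∈ P | ε ≤ r p}.ncard) (Metric.diam (chainSupp c)) :=
    fun d h => BallSystem.le_diamBound h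
  have hDc : 0 ≤ Metric.diam (chainSupp c) := Metric.diam_nonneg
  by_cases hsmall : Metric.diam (chainSupp c) ≤ θ
  · obtain ⟨d, hd, hfd, hsd⟩ := DChain.exists_filling_of_diam_le (δ := δ) hc (by linarith)
    refine ⟨d, hd, hfd, fun x hx p hp => hmem p hp x (hsupp (hsd hx) p hp),
      hbound d fun ε hε => ?_⟩
    have h1 := Metric.diam_mono hsd (DChain.finite_chainSupp c).isBounded
    have h2 := BallSystem.growth_iterate_nonneg hK0.le {p ∈ P | ε ≤ r p}.ncard
      (t := K * √(Metric.diam (chainSupp c))) (by positivity)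
    have h3 : 0 ≤ 10 * K * ε := by positivity
    nlinarith
  have hcne : (chainSupp c).Nonempty := by
    rw [Set.nonempty_iff_ne_empty]
    intro he
    rw [he, Metric.diam_empty] at hsmall
    exact hsmall hθ0.le
  obtain ⟨z, hz⟩ := hcne
  set s : 𝒮 → ℝ := fun p => r p / ((n + K) * M) with hs_def
  have hnK : 0 < (n + K : ℝ) := by positivity
  have hs : ∀ p ∈ P, 0 < s p := fun p hp => div_pos (hr p hp) (by positivity)
  have hsr1 : ∀ p ∈ P, s p ≤ r p := fun p hp =>
    div_le_self (hr p hp).le (one_le_mul_of_one_le_of_one_le (by linarith) hM1)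
  have hsr : ∀ p ∈ P, s p ≤ r p / K := fun p hp => by
    have := (hr p hp).le
    simp only [hs_def]
    gcongr
    nlinarith
  have hKs : ∀ p ∈ P, K * s p ≤ r p / M := fun p hp => by
    have := hr p hp
    simp only [hs_def]
    rw [← mul_div_assoc, div_le_div_iff₀ (by positivity) hM0]
    have : 0 ≤ r p * M * n := by positivity
    nlinarith
  have hsep : BallSystem.Separated K s P := by
    intro p hp q hq hpq hle x hxp hxq
    have hle' : r p ≤ r q := (div_le_div_iff_of_pos_right (by positivity)).1 hle
    have h := hstar p hp q hq hpq hle' ⟨x, hxp.trans (hKs p hp), hxq.trans (hKs q hq)⟩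
    have e : ∀ p, s p = r p / M / (n + K) := fun p => by
      rw [hs_def, div_div, mul_comm M]
    rw [e p, e q, div_right_comm (r q / M)]
    exact div_le_div_of_nonneg_right h hnK.le
  have hcs : ∀ x ∈ chainSupp c, ∀ p ∈ P, s p ≤ dist p x := fun x hx p hp => by
    refine le_trans ?_ (hsupp hx p hp)
    have := (hr p hp).le
    simp only [hs_def]
    gcongr
    linarith
  have hpush : ∀ q ∈ P, ∀ x : 𝒮, ∃ y, BallSystem.IsPush K s q {x} {y} := fun q hq x =>
    BallSystem.exists_push_point hK hg hF0 (hs q hq)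
      (z := z) (by rw [dist_comm]; exact hcs z hz q hq) x
  set F : Finset 𝒮 := (hfin θ hθ0).toFinset with hF_def
  have hFmem : ∀ p, p ∈ F ↔ p ∈ P ∧ θ ≤ r p := fun p => by simp [hF_def]
  have hFP : ↑F ⊆ P := fun p hp => ((hFmem p).1 hp).1
  have hFcard : {p ∈ P | θ ≤ r p}.ncard = F.card := Set.ncard_eq_toFinset_card _ (hfin θ hθ0)
  set δ' : ℝ := θ / (2 * ((n + K) * M)) with hδ'
  have hδ'0 : 0 < δ' := by positivity
  have hδ'θ : δ' ≤ θ := div_le_self hθ0.le (by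
    nlinarith [mul_le_mul (by linarith : (1 : ℝ) ≤ n + K) hM1 zero_le_one (by linarith)])
  have hδF : ∀ q ∈ F, δ' ≤ s q / 2 := fun q hq => by
    have h1 := ((hFmem q).1 hq).2
    have e : δ' = θ / ((n + K) * M) / 2 := by rw [hδ']; field_simp
    rw [e]
    simp only [hs_def]
    gcongr
  change FineLE (g^[{p ∈ P | θ ≤ r p}.ncard + 1] δ') c at hfine
  rw [hFcard, Function.iterate_succ_apply'] at hfine
  obtain ⟨d₀, hd₀, hfd₀, hdiam₀⟩ := hF0 (g^[F.card] δ')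
    (BallSystem.iterate_pos_le hg _ hδ'0).1 i hi.le c hc hfine
  obtain ⟨d, hd, hfd, hav, -, hZ⟩ := BallSystem.exists_avoiding_chain hK hg hF1 hsep hs hsr hi
    (d₀ := d₀) (by rw [hd₀]; exact ⟨z, hz⟩) F hFP hδ'0 hδF hfd₀
    (fun q hq x hx => hcs x (by rwa [hd₀] at hx) q (hFP hq))
  rw [hd₀] at hd
  have hnot : ∀ q ∈ P, q ∉ F → r q < θ := fun q hq hqF => by
    by_contra h
    exact hqF ((hFmem q).2 ⟨hq, not_lt.1 h⟩)
  have hv : ∀ x, ∃ y, x ∈ chainSupp d → dist y x ≤ 5 * K * θ ∧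
      (∀ p ∈ P, r p / ((⌈4 * K * (n + K)⌉₊ : ℝ) * M) ≤ dist p y) ∧
      ((∀ p ∈ P, r p / ((⌈4 * K * (n + K)⌉₊ : ℝ) * M) ≤ dist p x) → y = x) := by
    intro x
    by_cases hx : x ∈ chainSupp d
    swap
    · exact ⟨x, fun h => absurd h hx⟩
    by_cases hxf : ∀ p ∈ P, r p / ((⌈4 * K * (n + K)⌉₊ : ℝ) * M) ≤ dist p x
    · exact ⟨x, fun _ => ⟨by rw [dist_self]; positivity, hxf, fun _ => rfl⟩⟩
    obtain ⟨y, hy1, hy2⟩ := BallSystem.exists_close_avoiding_all hK hsep hs hpush hFP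
      (hav.mono (Set.singleton_subset_iff.2 hx)) hθ0.le
      (fun q hq hqF => (hsr1 q hq).trans (hnot q hq hqF).le)
      (fun q hq hqF p hp => by
        have := (hnot q hq hqF).le.trans ((hFmem p).1 hp).2
        simp only [hs_def]
        gcongr)
    refine ⟨y, fun _ => ⟨hy1, fun p hp => le_trans ?_ (hy2 p hp), fun h => absurd h hxf⟩⟩
    have := (hr p hp).le
    simp only [hs_def]
    rw [div_div]
    refine div_le_div_of_nonneg_left this (by positivity) ?_
    nlinarith [mul_le_mul_of_nonneg_right (hfM n) hM0.le]
  choose v hv using hv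
  have hcd : chainSupp c ⊆ chainSupp d := hd ▸ DChain.chainSupp_dbd_subset d
  have hvc : vmap v c = c := DChain.vmap_eq_self fun x hx =>
    (hv x (hcd hx)).2.2 fun p hp => hmem p hp x (hsupp hx p hp)
  have hvdist : ∀ x ∈ chainSupp d, ∀ y ∈ chainSupp d,
      dist (v x) (v y) ≤ dist x y + 10 * K * θ := fun x hx y hy => by
    have h1 := (hv x hx).1
    have h2 := (hv y hy).1
    have h3 := dist_triangle4 (v x) x y (v y)
    rw [dist_comm y (v y)] at h3
    linarith
  refine ⟨vmap v d, by rw [DChain.dbd_vmap, hd, hvc], ?_, ?_, hbound _ fun ε hε => ?_⟩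
  · refine DChain.fineLE_of_dist hδ.le fun τ hτ a b => ?_
    obtain ⟨σ, hσ, rfl⟩ := DChain.exists_of_mem_support_vmap hτ
    have h1 := hvdist (σ a) (DChain.mem_chainSupp.2 ⟨σ, hσ, a, rfl⟩)
      (σ b) (DChain.mem_chainSupp.2 ⟨σ, hσ, b, rfl⟩)
    have h2 := DChain.dist_le_of_fine hfd hσ a b
    simp only [Function.comp_apply]
    linarith
  · intro y hy
    obtain ⟨x, hx, rfl⟩ := DChain.chainSupp_vmap_subset v d hy
    exact (hv x hx).2.1
  · obtain ⟨Z, hZf, hZn, F', hF'F, hF'ε, hZd, hZp⟩ := hZ ε hε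
    have h1 : Metric.diam (chainSupp d) ≤ Metric.diam Z + 2 * (5 * K * ε) := by
      refine BallSystem.diam_le_of_infDist_le (by positivity) hZf hZn fun x hx => ?_
      have := hZp.le hK0.le (fun p hp => (hs p (hFP hp)).le) hε.le hx
      simpa using this
    have hcard : F'.card ≤ {p ∈ P | ε ≤ r p}.ncard := by
      rw [← Set.ncard_coe_finset]
      refine Set.ncard_le_ncard (fun p hp => ?_) (hfin ε hε)
      have hpP := hFP (hF'F hp)
      exact ⟨hpP, (hF'ε p hp).trans (hsr1 p hpP)⟩
    have h2 := hZd.trans (BallSystem.growth_iterate_le hK0.le hcard hdiam₀)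
    have h3 : Metric.diam (chainSupp (vmap v d)) ≤
        Metric.diam (chainSupp d) + 10 * K * θ := by
      refine Metric.diam_le_of_forall_dist_le (by positivity) fun a ha b hb => ?_
      obtain ⟨x, hx, rfl⟩ := DChain.chainSupp_vmap_subset v d ha
      obtain ⟨y, hy, rfl⟩ := DChain.chainSupp_vmap_subset v d hb
      have := Metric.dist_le_diam_of_mem (DChain.finite_chainSupp d).isBounded hx hy
      have := hvdist x hx y hy
      linarith
    have h4 : 10 * K * θ ≤ 10 * K * Metric.diam (chainSupp c) := by
      have := (not_le.1 hsmall).le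
      gcongr
    linarith
end
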